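/- arXiv:2603.11217 — 2 statements merged into one kernel-verified Lean document; each statement's English description precedes it below -/
import Mathlib

section
/- Let Ω ⊆ ℝ^n be a domain, p > n, and let f ∈ W^{1,p}(Ω : ℝ^N) be continuous. If E ⊆ Ω has σ-finite ℋ^s measure for some s ∈ (0,n), then ℋ^{s'}(f(E)) = 0, where s' = ps/(p−n+s). In particular, for every E ⊆ Ω with dimH E ∈ (0,n), dimH f(E) ≤ p·dimH E/(p − n + dimH E). -/
open Set Filter MeasureTheory Metric Topology
open scoped ENNReal NNReal

noncomputable section

/-- The maximal stretch `L_f(x,r) = sup {dist (f y) (f x) : y ∈ Ω, dist y x = r}`. -/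
def maxStretch {X Y : Type*} [MetricSpace X] [MetricSpace Y]
    (Ω : Set X) (f : X → Y) (x : X) (r : ℝ) : ℝ :=
  sSup ((fun y => dist (f y) (f x)) '' {y ∈ Ω | dist y x = r})

/-- The minimal stretch `ℓ_f(x,r) = inf {dist (f y) (f x) : y ∈ Ω, dist y x = r}`. -/
def minStretch {X Y : Type*} [MetricSpace X] [MetricSpace Y]
    (Ω : Set X) (f : X → Y) (x : X) (r : ℝ) : ℝ :=
  sInf ((fun y => dist (f y) (f x)) '' {y ∈ Ω | dist y x = r})

/-- `f` is a homeomorphism of `Ω` onto `Ω'`. -/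
def IsHomeoOn {X Y : Type*} [TopologicalSpace X] [TopologicalSpace Y]
    (f : X → Y) (Ω : Set X) (Ω' : Set Y) : Prop :=
  Set.BijOn f Ω Ω' ∧ ContinuousOn f Ω ∧
    ∃ g : Y → X, Set.InvOn g f Ω Ω' ∧ ContinuousOn g Ω'

/-- `f : Ω → Ω'` is a `K`-quasiconformal homeomorphism:
it is a homeomorphism of `Ω` onto `Ω'` and
`limsup_{r → 0⁺} L_f(x,r)/ℓ_f(x,r) ≤ K` for every `x ∈ Ω`. -/
def IsQCHomeoOn {X Y : Type*} [MetricSpace X] [MetricSpace Y]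
    (K : ℝ) (f : X → Y) (Ω : Set X) (Ω' : Set Y) : Prop :=
  IsHomeoOn f Ω Ω' ∧
    ∀ x ∈ Ω, Filter.limsup (fun r => maxStretch Ω f x r / minStretch Ω f x r)
      (𝓝[>] (0:ℝ)) ≤ K

/-- A domain: a nonempty open connected set. -/
def IsEuclDomain {X : Type*} [TopologicalSpace X] (Ω : Set X) : Prop :=
  IsOpen Ω ∧ IsConnected Ω

/-- A continuous map `f` belongs to `W^{1,p}(Ω : ℝ^N)`: there is a locally integrable
weak derivative `Df : Ω → (ℝ^n →L ℝ^N)` with `∫_Ω ‖Df‖^p < ∞`. -/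
def MemW1p (n N : ℕ) (p : ℝ) (Ω : Set (EuclideanSpace ℝ (Fin n)))
    (f : EuclideanSpace ℝ (Fin n) → EuclideanSpace ℝ (Fin N)) : Prop :=
  ∃ Df : EuclideanSpace ℝ (Fin n) → (EuclideanSpace ℝ (Fin n) →L[ℝ] EuclideanSpace ℝ (Fin N)),
    LocallyIntegrableOn Df Ω volume ∧
    (∫⁻ x in Ω, ENNReal.ofReal (‖Df x‖ ^ p) ∂volume) < ⊤ ∧
    ∀ φ : EuclideanSpace ℝ (Fin n) → ℝ, ContDiff ℝ (⊤ : ℕ∞) φ → HasCompactSupport φ →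
      tsupport φ ⊆ Ω → ∀ v : EuclideanSpace ℝ (Fin n),
        (∫ x in Ω, (fderiv ℝ φ x v) • f x ∂volume) = - ∫ x in Ω, (φ x) • (Df x v) ∂volume

/-- `f ∈ W^{1,p}_loc(Ω : ℝ^N)`: the restriction of `f` to every open set compactly
contained in `Ω` belongs to `W^{1,p}`. -/
def MemW1pLoc (n N : ℕ) (p : ℝ) (Ω : Set (EuclideanSpace ℝ (Fin n)))
    (f : EuclideanSpace ℝ (Fin n) → EuclideanSpace ℝ (Fin N)) : Prop :=
  ∀ U : Set (EuclideanSpace ℝ (Fin n)), IsOpen U → IsCompact (closure U) →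
    closure U ⊆ Ω → MemW1p n N p U f

section Morrey

variable {n N : ℕ}

local notation "𝔼" => EuclideanSpace ℝ (Fin n)
local notation "𝔽" => EuclideanSpace ℝ (Fin N)

/-- A continuous function with compact support inside `Ω`, times a function which is locally
integrable on `Ω`, is integrable on `Ω`. -/
lemma integrableOn_smul_of_tsupport_subset {V : Type*} [NormedAddCommGroup V] [NormedSpace ℝ V]
    {Ω : Set 𝔼} {χ : 𝔼 → ℝ} {g : 𝔼 → V} (hg : LocallyIntegrableOn g Ω volume)
    (hχ : Continuous χ) (hc : HasCompactSupport χ) (hs : tsupport χ ⊆ Ω) :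
    IntegrableOn (fun y => χ y • g y) Ω volume := by
  have h1 : IntegrableOn (fun y => χ y • g y) (tsupport χ) volume :=
    (hg.integrableOn_compact_subset hs hc).continuousOn_smul hχ.continuousOn hc
  have h2 : Function.support (fun y => χ y • g y) ⊆ tsupport χ := fun y hy =>
    subset_tsupport _ (fun h0 => hy (by simp [h0]))
  exact ((integrableOn_iff_integrable_of_support_subset h2).1 h1).integrableOn

/-- The weak derivative tested against the vector field `y ↦ χ y • (y - x)`. -/
lemma integral_divergence_smul {Ω : Set 𝔼} (hΩ : IsOpen Ω) {f : 𝔼 → 𝔽} (hfc : ContinuousOn f Ω)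
    {Df : 𝔼 → (𝔼 →L[ℝ] 𝔽)} (hDf : LocallyIntegrableOn Df Ω volume)
    (hw : ∀ φ : 𝔼 → ℝ, ContDiff ℝ (⊤ : ℕ∞) φ → HasCompactSupport φ →
      tsupport φ ⊆ Ω → ∀ v : 𝔼,
        (∫ x in Ω, (fderiv ℝ φ x v) • f x ∂volume) = - ∫ x in Ω, (φ x) • (Df x v) ∂volume)
    {χ : 𝔼 → ℝ} (hχ : ContDiff ℝ (⊤ : ℕ∞) χ) (hc : HasCompactSupport χ)
    (hs : tsupport χ ⊆ Ω) (x : 𝔼) :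
    (∫ y in Ω, (n * χ y + fderiv ℝ χ y (y - x)) • f y) = - ∫ y in Ω, χ y • Df y (y - x) := by
  have hfl : LocallyIntegrableOn f Ω volume := hfc.locallyIntegrableOn hΩ.measurableSet
  let e := EuclideanSpace.basisFun (Fin n) ℝ
  let φ : Fin n → 𝔼 → ℝ := fun i y => χ y * (y - x) i
  have hsum : ∀ v : 𝔼, ∑ i, v i • e i = v := fun v => by
    simpa [e] using (EuclideanSpace.basisFun (Fin n) ℝ).sum_repr v
  have hco : ∀ i, ContDiff ℝ (⊤ : ℕ∞) (fun y : 𝔼 => (y - x) i) := fun i =>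
    (EuclideanSpace.proj (𝕜 := ℝ) i).contDiff.comp (contDiff_id.sub contDiff_const)
  have hφd : ∀ i, ContDiff ℝ (⊤ : ℕ∞) (φ i) := fun i => hχ.mul (hco i)
  have hφc : ∀ i, HasCompactSupport (φ i) := fun i => hc.mul_right
  have hφs : ∀ i, tsupport (φ i) ⊆ Ω := fun i => (tsupport_mul_subset_left).trans hs
  have hφ' : ∀ i y, fderiv ℝ (φ i) y (e i) = χ y + (y - x) i * fderiv ℝ χ y (e i) := by
    intro i y
    have h1 : HasFDerivAt χ (fderiv ℝ χ y) y := (hχ.differentiable (by simp) y).hasFDerivAt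
    have h2 : HasFDerivAt (fun y : 𝔼 => (y - x) i) (EuclideanSpace.proj (𝕜 := ℝ) i : 𝔼 →L[ℝ] ℝ) y :=
      (EuclideanSpace.proj (𝕜 := ℝ) i : 𝔼 →L[ℝ] ℝ).hasFDerivAt.comp y
        ((hasFDerivAt_id y).sub_const x)
    have h3 : HasFDerivAt (φ i) _ y := h1.mul h2
    rw [h3.fderiv]
    simp [e]
  have key : ∀ i, (∫ y in Ω, (χ y + (y - x) i * fderiv ℝ χ y (e i)) • f y)
      = - ∫ y in Ω, φ i y • Df y (e i) := by
    intro i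
    rw [← hw (φ i) (hφd i) (hφc i) (hφs i) (e i)]
    simp_rw [hφ']
  have hint1 : ∀ i, IntegrableOn (fun y => (χ y + (y - x) i * fderiv ℝ χ y (e i)) • f y) Ω := by
    intro i
    have h := integrableOn_smul_of_tsupport_subset hfl
      (χ := fun y => fderiv ℝ (φ i) y (e i))
      (((hφd i).continuous_fderiv (by simp)).clm_apply continuous_const)
      ((hφc i).fderiv_apply (𝕜 := ℝ) (e i)) ((tsupport_fderiv_apply_subset ℝ (e i)).trans (hφs i))
    simpa only [hφ'] using h
  have hint2 : ∀ i, IntegrableOn (fun y => φ i y • Df y (e i)) Ω := by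
    intro i
    have h := integrableOn_smul_of_tsupport_subset hDf (hφd i).continuous (hφc i) (hφs i)
    exact h.apply_continuousLinearMap (e i)
  calc (∫ y in Ω, (n * χ y + fderiv ℝ χ y (y - x)) • f y)
      = ∫ y in Ω, ∑ i, (χ y + (y - x) i * fderiv ℝ χ y (e i)) • f y := by
        congr 1; ext1 y
        rw [← Finset.sum_smul]
        congr 1
        conv_lhs => rw [← hsum (y - x)]
        simp [Finset.sum_add_distrib, map_sum, e]
    _ = ∑ i, ∫ y in Ω, (χ y + (y - x) i * fderiv ℝ χ y (e i)) • f y :=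
        integral_finsetSum _ fun i _ => hint1 i
    _ = - ∑ i, ∫ y in Ω, φ i y • Df y (e i) := by
        simp_rw [key]; rw [Finset.sum_neg_distrib]
    _ = - ∫ y in Ω, ∑ i, φ i y • Df y (e i) := by
        rw [integral_finsetSum _ fun i _ => hint2 i]
    _ = - ∫ y in Ω, χ y • Df y (y - x) := by
        congr 2; ext1 y
        conv_rhs => rw [← hsum (y - x)]
        simp only [map_sum, map_smul, Finset.smul_sum, φ, mul_smul]

/-- The kernel `φ` rescaled by the factor `t` about the point `x`, with unchanged mass. -/
def scaledKernel (φ : 𝔼 → ℝ) (x : 𝔼) (t : ℝ) (y : 𝔼) : ℝ :=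
  (t ^ n)⁻¹ * φ (x + t⁻¹ • (y - x))

/-- The radial derivative of `scaledKernel`. -/
def scaledKernelDeriv (φ : 𝔼 → ℝ) (x : 𝔼) (t : ℝ) (y : 𝔼) : ℝ :=
  -(t⁻¹ * (n * scaledKernel φ x t y
    + (t ^ n)⁻¹ * (t⁻¹ * fderiv ℝ φ (x + t⁻¹ • (y - x)) (y - x))))

lemma contDiff_scaledKernel {φ : 𝔼 → ℝ} (hφ : ContDiff ℝ (⊤ : ℕ∞) φ) (x : 𝔼) (t : ℝ) :
    ContDiff ℝ (⊤ : ℕ∞) (scaledKernel φ x t) := by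
  unfold scaledKernel
  fun_prop

lemma fderiv_scaledKernel {φ : 𝔼 → ℝ} (hφ : ContDiff ℝ (⊤ : ℕ∞) φ) (x : 𝔼) (t : ℝ) (y v : 𝔼) :
    fderiv ℝ (scaledKernel φ x t) y v
      = (t ^ n)⁻¹ * (t⁻¹ * fderiv ℝ φ (x + t⁻¹ • (y - x)) v) := by
  have h1 : HasFDerivAt φ (fderiv ℝ φ (x + t⁻¹ • (y - x))) (x + t⁻¹ • (y - x)) :=
    (hφ.differentiable (by simp) _).hasFDerivAt
  have h2 : HasFDerivAt (fun y : 𝔼 => x + t⁻¹ • (y - x))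
      (t⁻¹ • ContinuousLinearMap.id ℝ 𝔼) y :=
    (((hasFDerivAt_id y).sub_const x).const_smul t⁻¹).const_add x
  have h3 : HasFDerivAt (scaledKernel φ x t) _ y := (h1.comp y h2).const_mul ((t ^ n)⁻¹)
  rw [h3.fderiv]
  simp

lemma hasDerivAt_scaledKernel {φ : 𝔼 → ℝ} (hφ : ContDiff ℝ (⊤ : ℕ∞) φ) (x y : 𝔼) {t : ℝ}
    (ht : 0 < t) :
    HasDerivAt (fun t => scaledKernel φ x t y) (scaledKernelDeriv φ x t y) t := by
  have h1 : HasFDerivAt φ (fderiv ℝ φ (x + t⁻¹ • (y - x))) (x + t⁻¹ • (y - x)) :=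
    (hφ.differentiable (by simp) _).hasFDerivAt
  have h2 : HasDerivAt (fun t : ℝ => x + t⁻¹ • (y - x)) ((-(t ^ 2)⁻¹) • (y - x)) t :=
    ((hasDerivAt_inv ht.ne').smul_const (y - x)).const_add x
  have h3 : HasDerivAt (fun t : ℝ => (t ^ n)⁻¹) _ t := (hasDerivAt_pow n t).inv (by positivity)
  have h4 : HasDerivAt (fun t => scaledKernel φ x t y) _ t := h3.mul (h1.comp_hasDerivAt t h2)
  convert h4 using 1
  simp only [scaledKernelDeriv, scaledKernel, map_smul, smul_eq_mul]
  have h0 : t ≠ 0 := ht.ne'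
  rcases Nat.eq_zero_or_pos n with h | h
  · subst h
    field_simp
    simp
  · obtain ⟨m, rfl⟩ : ∃ m, n = m + 1 := ⟨n - 1, by omega⟩
    simp only [Nat.add_sub_cancel]
    field_simp
    ring

lemma continuousOn_scaledKernelDeriv {φ : 𝔼 → ℝ} (hφ : ContDiff ℝ (⊤ : ℕ∞) φ) (x : 𝔼) :
    ContinuousOn (fun q : ℝ × 𝔼 => scaledKernelDeriv φ x q.1 q.2) (Ioi 0 ×ˢ univ) := by
  have hi : ContinuousOn (fun q : ℝ × 𝔼 => q.1⁻¹) (Ioi 0 ×ˢ univ) :=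
    continuousOn_fst.inv₀ fun q hq => (mem_Ioi.1 hq.1).ne'
  have hp : ContinuousOn (fun q : ℝ × 𝔼 => (q.1 ^ n)⁻¹) (Ioi 0 ×ˢ univ) :=
    (continuousOn_fst.pow n).inv₀ fun q hq => (pow_pos (mem_Ioi.1 hq.1) n).ne'
  have hs : ContinuousOn (fun q : ℝ × 𝔼 => q.2 - x) (Ioi 0 ×ˢ univ) := by fun_prop
  have ha : ContinuousOn (fun q : ℝ × 𝔼 => x + q.1⁻¹ • (q.2 - x)) (Ioi 0 ×ˢ univ) :=
    continuousOn_const.add (hi.smul hs)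
  have h1 := hφ.continuous.comp_continuousOn ha
  have h2 := (hφ.continuous_fderiv (by simp)).comp_continuousOn ha
  unfold scaledKernelDeriv scaledKernel
  exact (hi.mul ((continuousOn_const.mul (hp.mul h1)).add
    (hp.mul (hi.mul (h2.clm_apply hs))))).neg

/-- Differentiation of the rescaled averages with respect to the scale. -/
lemma hasDerivAt_integral_scaledKernel {K : Set 𝔼} (hK : IsCompact K) {f : 𝔼 → 𝔽}
    (hf : ContinuousOn f K) {φ : 𝔼 → ℝ} (hφ : ContDiff ℝ (⊤ : ℕ∞) φ) (x : 𝔼) {t : ℝ}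
    (ht : 0 < t) :
    HasDerivAt (fun t => ∫ y in K, scaledKernel φ x t y • f y)
      (∫ y in K, scaledKernelDeriv φ x t y • f y) t := by
  have hsub : Icc (t / 2) (2 * t) ×ˢ K ⊆ Ioi (0 : ℝ) ×ˢ univ :=
    fun q hq => ⟨lt_of_lt_of_le (by positivity) hq.1.1, mem_univ _⟩
  have hc : ContinuousOn (fun q : ℝ × 𝔼 => scaledKernelDeriv φ x q.1 q.2 • f q.2)
      (Icc (t / 2) (2 * t) ×ˢ K) :=
    ((continuousOn_scaledKernelDeriv hφ x).mono hsub).smul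
      (hf.comp continuousOn_snd fun q hq => hq.2)
  obtain ⟨B, hB⟩ := (isCompact_Icc.prod hK).exists_bound_of_continuousOn hc
  have hint : ∀ t : ℝ, IntegrableOn (fun y => scaledKernel φ x t y • f y) K volume := fun t =>
    ((contDiff_scaledKernel hφ x t).continuous.continuousOn.smul hf).integrableOn_compact hK
  have hmem : t ∈ Icc (t / 2) (2 * t) := ⟨by linarith, by linarith⟩
  have hder : ContinuousOn (fun y => scaledKernelDeriv φ x t y • f y) K :=
    hc.comp (f := fun y => (t, y)) (by fun_prop) fun y hy => ⟨hmem, hy⟩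
  refine (hasDerivAt_integral_of_dominated_loc_of_deriv_le (bound := fun _ => B)
    (s := Icc (t / 2) (2 * t)) (F' := fun t y => scaledKernelDeriv φ x t y • f y)
    (Icc_mem_nhds (by linarith) (by linarith))
    (Eventually.of_forall fun t => (hint t).aestronglyMeasurable) (hint t)
    (hder.integrableOn_compact hK).aestronglyMeasurable ?_ ?_ ?_).2
  · filter_upwards [ae_restrict_mem hK.measurableSet] with y hy s hs
    exact hB (s, y) ⟨hs, hy⟩
  · exact integrableOn_const hK.measure_lt_top.ne
  · filter_upwards with y s hs
    exact (hasDerivAt_scaledKernel hφ x y (lt_of_lt_of_le (by positivity) hs.1)).smul_const (f y)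

lemma tsupport_scaledKernel_subset {φ : 𝔼 → ℝ} {c : 𝔼} {ρ : ℝ}
    (hφ : tsupport φ ⊆ closedBall c ρ) (x : 𝔼) {t : ℝ} (ht : 0 < t) :
    tsupport (scaledKernel φ x t) ⊆ closedBall (x + t • (c - x)) (t * ρ) := by
  refine closure_minimal (fun y hy => ?_) isClosed_closedBall
  have h1 : φ (x + t⁻¹ • (y - x)) ≠ 0 := fun h => hy (by simp [scaledKernel, h])
  have h2 := hφ (subset_tsupport _ h1)
  rw [mem_closedBall, dist_eq_norm] at h2 ⊢
  have h3 : y - (x + t • (c - x)) = t • (x + t⁻¹ • (y - x) - c) := by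
    simp only [smul_sub, smul_add, smul_smul, mul_inv_cancel₀ ht.ne', one_smul]
    abel
  rw [h3, norm_smul, Real.norm_of_nonneg ht.le]
  gcongr

lemma integral_scaledKernel (φ : 𝔼 → ℝ) (x : 𝔼) {t : ℝ} (ht : 0 < t) :
    ∫ y, scaledKernel φ x t y = ∫ y, φ y := by
  unfold scaledKernel
  rw [integral_const_mul, integral_sub_right_eq_self (fun y => φ (x + t⁻¹ • y)) x,
    Measure.integral_comp_inv_smul_of_nonneg volume (fun y => φ (x + y)) ht.le,
    integral_add_left_eq_self]
  simp only [finrank_euclideanSpace, Fintype.card_fin, smul_eq_mul]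
  field_simp

lemma exists_mem_closedBall_of_mem_scaled {x c y : 𝔼} {ρ t : ℝ} (ht : 0 < t)
    (hy : y ∈ closedBall (x + t • (c - x)) (t * ρ)) :
    ∃ z ∈ closedBall c ρ, y = x + t • (z - x) := by
  refine ⟨x + t⁻¹ • (y - x), ?_, by simp [smul_smul, mul_inv_cancel₀ ht.ne']⟩
  rw [mem_closedBall, dist_eq_norm] at hy ⊢
  have h3 : y - (x + t • (c - x)) = t • (x + t⁻¹ • (y - x) - c) := by
    simp only [smul_sub, smul_add, smul_smul, mul_inv_cancel₀ ht.ne', one_smul]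
    abel
  rw [h3, norm_smul, Real.norm_of_nonneg ht.le] at hy
  exact le_of_mul_le_mul_left hy ht

lemma add_smul_sub_mem_of_convex {Q : Set 𝔼} (hQ : Convex ℝ Q) {x z : 𝔼} (hx : x ∈ Q)
    (hz : z ∈ Q) {t : ℝ} (h0 : 0 < t) (h1 : t ≤ 1) : x + t • (z - x) ∈ Q :=
  hQ.add_smul_sub_mem hx hz ⟨h0.le, h1⟩

lemma volume_closedBall_scaled (c d : 𝔼) {ρ t : ℝ} (hρ : 0 ≤ ρ) (ht : 0 ≤ t) :
    volume (closedBall d (t * ρ)) = ENNReal.ofReal (t ^ n * volume.real (closedBall c ρ)) := by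
  rw [ENNReal.ofReal_mul (by positivity), ofReal_measureReal measure_closedBall_lt_top.ne,
    Measure.addHaar_closedBall _ _ (by positivity), Measure.addHaar_closedBall _ _ hρ, ← mul_assoc,
    ← ENNReal.ofReal_mul (by positivity)]
  simp [mul_pow]

lemma lintegral_enorm_le_rpow_mul {V : Type*} [NormedAddCommGroup V] {p : ℝ} (hp : 1 < p)
    {S : Set 𝔼} {g : 𝔼 → V} (hg : AEStronglyMeasurable g (volume.restrict S)) :
    ∫⁻ y in S, ‖g y‖ₑ ≤ (∫⁻ y in S, ‖g y‖ₑ ^ p) ^ (1 / p) * volume S ^ (1 - 1 / p) := by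
  have hp0 : 0 < p := by linarith
  have h := ENNReal.lintegral_mul_norm_pow_le (μ := volume.restrict S)
    (f := fun y => ‖g y‖ₑ ^ p) (g := fun _ => 1) (hg.enorm.pow_const p) aemeasurable_const
    (p := 1 / p) (q := 1 - 1 / p) (by positivity)
    (by rw [sub_nonneg, div_le_one hp0]; exact hp.le) (by ring)
  simpa [← ENNReal.rpow_mul, hp0.ne'] using h

lemma norm_integral_scaledKernel_smul_le {Ω Q : Set 𝔼} (hΩ : IsOpen Ω) {Df : 𝔼 → (𝔼 →L[ℝ] 𝔽)}
    (hDf : LocallyIntegrableOn Df Ω volume) {p : ℝ} (hp : 1 < p)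
    (hQ : Convex ℝ Q) (hQΩ : Q ⊆ Ω) {x c : 𝔼} (hx : x ∈ Q) {ρ : ℝ} (hρ : 0 < ρ)
    (hcQ : closedBall c ρ ⊆ Q) {D : ℝ} (hD : ∀ y ∈ Q, ‖y - x‖ ≤ D)
    (hI : ∫⁻ y in Q, ‖Df y‖ₑ ^ p < ⊤) {φ : 𝔼 → ℝ} (hφs : tsupport φ ⊆ closedBall c ρ)
    {M : ℝ} (hM : ∀ y, |φ y| ≤ M) {t : ℝ} (h0 : 0 < t) (h1 : t ≤ 1) :
    ‖∫ y in Ω, scaledKernel φ x t y • Df y (y - x)‖ ≤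
      D * M * (∫⁻ y in Q, ‖Df y‖ₑ ^ p).toReal ^ (1 / p)
        * volume.real (closedBall c ρ) ^ (1 - 1 / p) * t ^ (1 - n / p) := by
  set S := closedBall (x + t • (c - x)) (t * ρ) with hS
  set I := ∫⁻ y in Q, ‖Df y‖ₑ ^ p with hIdef
  set W := volume.real (closedBall c ρ) with hW
  have hp0 : 0 < p := by linarith
  have hSQ : S ⊆ Q := fun y hy => by
    obtain ⟨z, hz, rfl⟩ := exists_mem_closedBall_of_mem_scaled h0 hy
    exact add_smul_sub_mem_of_convex hQ hx (hcQ hz) h0 h1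
  have hD0 : 0 ≤ D := (norm_nonneg _).trans (hD x hx)
  have hM0 : 0 ≤ M := (abs_nonneg _).trans (hM x)
  have hSx : ∀ y ∈ S, ‖y - x‖ ≤ t * D := fun y hy => by
    obtain ⟨z, hz, rfl⟩ := exists_mem_closedBall_of_mem_scaled h0 hy
    rw [add_sub_cancel_left, norm_smul, Real.norm_of_nonneg h0.le]
    gcongr
    exact hD z (hcQ hz)
  have hzero : ∀ y ∈ Ω \ S, scaledKernel φ x t y • Df y (y - x) = 0 := fun y hy => by
    have : scaledKernel φ x t y = 0 := by
      by_contra h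
      exact hy.2 (tsupport_scaledKernel_subset hφs x h0 (subset_tsupport _ h))
    simp [this]
  rw [setIntegral_eq_of_subset_of_forall_sdiff_eq_zero hΩ.measurableSet (hSQ.trans hQΩ) hzero]
  set a : ℝ := (t ^ n)⁻¹ * M * (t * D) with ha
  have ha0 : 0 ≤ a := by positivity
  have hpt : ∀ y ∈ S, ‖scaledKernel φ x t y • Df y (y - x)‖ₑ ≤ ENNReal.ofReal a * ‖Df y‖ₑ := by
    intro y hy
    rw [← ofReal_norm, ← ofReal_norm, ← ENNReal.ofReal_mul ha0]
    refine ENNReal.ofReal_le_ofReal ?_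
    rw [norm_smul, scaledKernel, norm_mul, Real.norm_of_nonneg (by positivity), Real.norm_eq_abs]
    calc (t ^ n)⁻¹ * |φ (x + t⁻¹ • (y - x))| * ‖(Df y) (y - x)‖
        ≤ (t ^ n)⁻¹ * M * (‖Df y‖ * (t * D)) := by
          gcongr
          · exact hM _
          · exact (Df y).le_opNorm_of_le (hSx y hy)
      _ = a * ‖Df y‖ := by rw [ha]; ring
  have hmeas : AEStronglyMeasurable Df (volume.restrict S) :=
    hDf.aestronglyMeasurable.mono_set (hSQ.trans hQΩ)
  have hmain : ‖∫ y in S, scaledKernel φ x t y • Df y (y - x)‖ₑ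
      ≤ ENNReal.ofReal (a * (I.toReal ^ (1 / p) * (t ^ n * W) ^ (1 - 1 / p))) := by
    calc ‖∫ y in S, scaledKernel φ x t y • Df y (y - x)‖ₑ
        ≤ ∫⁻ y in S, ‖scaledKernel φ x t y • Df y (y - x)‖ₑ := enorm_integral_le_lintegral_enorm _
      _ ≤ ∫⁻ y in S, ENNReal.ofReal a * ‖Df y‖ₑ :=
          setLIntegral_mono' measurableSet_closedBall hpt
      _ = ENNReal.ofReal a * ∫⁻ y in S, ‖Df y‖ₑ := lintegral_const_mul' _ _ (by simp)
      _ ≤ ENNReal.ofReal a * (I ^ (1 / p) * volume S ^ (1 - 1 / p)) := by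
          gcongr
          refine (lintegral_enorm_le_rpow_mul hp hmeas).trans ?_
          gcongr
          exact lintegral_mono_set hSQ
      _ = ENNReal.ofReal (a * (I.toReal ^ (1 / p) * (t ^ n * W) ^ (1 - 1 / p))) := by
          have hq : 0 ≤ 1 - 1 / p := by
            rw [sub_nonneg, div_le_one hp0]; exact hp.le
          rw [ENNReal.ofReal_mul (p := a) ha0,
            ENNReal.ofReal_mul (p := I.toReal ^ (1 / p)) (by positivity),
            ← ENNReal.ofReal_rpow_of_nonneg (by positivity) (by positivity),
            ← ENNReal.ofReal_rpow_of_nonneg (by positivity) hq,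
            ENNReal.ofReal_toReal hI.ne, hS, volume_closedBall_scaled c _ hρ.le h0.le]
  rw [← ofReal_norm, ENNReal.ofReal_le_ofReal_iff (by positivity)] at hmain
  refine hmain.trans (le_of_eq ?_)
  have ht : (t ^ n)⁻¹ * t * (t ^ n) ^ (1 - 1 / p) = t ^ (1 - n / p) := by
    rw [← Real.rpow_natCast, ← Real.rpow_neg h0.le, ← Real.rpow_mul h0.le]
    nth_rw 2 [← Real.rpow_one t]
    rw [← Real.rpow_add h0, ← Real.rpow_add h0]
    congr 1
    ring
  rw [Real.mul_rpow (by positivity) (by positivity), ← ht, ha]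
  ring

lemma norm_sub_integral_smul_le {Ω Q : Set 𝔼} (hΩ : IsOpen Ω) {f : 𝔼 → 𝔽}
    (hfc : ContinuousOn f Ω) {Df : 𝔼 → (𝔼 →L[ℝ] 𝔽)}
    (hDf : LocallyIntegrableOn Df Ω volume)
    (hw : ∀ φ : 𝔼 → ℝ, ContDiff ℝ (⊤ : ℕ∞) φ → HasCompactSupport φ →
      tsupport φ ⊆ Ω → ∀ v : 𝔼,
        (∫ x in Ω, (fderiv ℝ φ x v) • f x ∂volume) = - ∫ x in Ω, (φ x) • (Df x v) ∂volume)
    {p : ℝ} (hp : 1 < p) (hnp : n < p)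
    (hQ : Convex ℝ Q) (hQΩ : Q ⊆ Ω) {x c : 𝔼} (hx : x ∈ Q) {ρ : ℝ} (hρ : 0 < ρ)
    (hcQ : closedBall c ρ ⊆ Q) {D : ℝ} (hD : ∀ y ∈ Q, ‖y - x‖ ≤ D)
    (hI : ∫⁻ y in Q, ‖Df y‖ₑ ^ p < ⊤) {φ : 𝔼 → ℝ} (hφ : ContDiff ℝ (⊤ : ℕ∞) φ)
    (hφs : tsupport φ ⊆ closedBall c ρ) (hφ0 : ∀ y, 0 ≤ φ y) (hφ1 : ∫ y, φ y = 1)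
    {M : ℝ} (hM : ∀ y, φ y ≤ M) :
    ‖(∫ y in Ω, φ y • f y) - f x‖ ≤
      D * M * (∫⁻ y in Q, ‖Df y‖ₑ ^ p).toReal ^ (1 / p)
        * volume.real (closedBall c ρ) ^ (1 - 1 / p) / (1 - n / p) := by
  have hp0 : 0 < p := by linarith
  have hα : 0 < 1 - n / p := by rw [sub_pos, div_lt_one hp0]; exact hnp
  have hD0 : 0 ≤ D := (norm_nonneg _).trans (hD x hx)
  have hM0 : 0 ≤ M := (hφ0 x).trans (hM x)
  set C := D * M * (∫⁻ y in Q, ‖Df y‖ₑ ^ p).toReal ^ (1 / p)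
        * volume.real (closedBall c ρ) ^ (1 - 1 / p) with hC
  have hC0 : 0 ≤ C := by positivity
  set K : Set 𝔼 := (fun q : ℝ × 𝔼 => x + q.1 • (q.2 - x)) '' (Icc 0 1 ×ˢ closedBall c ρ) with hKdef
  have hK : IsCompact K :=
    (isCompact_Icc.prod (isCompact_closedBall c ρ)).image (by fun_prop)
  have hKQ : K ⊆ Q := by
    rintro _ ⟨⟨t, z⟩, ⟨ht, hz⟩, rfl⟩
    exact hQ.add_smul_sub_mem hx (hcQ hz) ht
  have hKΩ : K ⊆ Ω := hKQ.trans hQΩ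
  have hSK : ∀ t : ℝ, 0 < t → t ≤ 1 → closedBall (x + t • (c - x)) (t * ρ) ⊆ K := by
    intro t h0 h1 y hy
    obtain ⟨z, hz, rfl⟩ := exists_mem_closedBall_of_mem_scaled h0 hy
    exact ⟨(t, z), ⟨⟨h0.le, h1⟩, hz⟩, rfl⟩
  have hχK : ∀ t : ℝ, 0 < t → t ≤ 1 → tsupport (scaledKernel φ x t) ⊆ K := fun t h0 h1 =>
    (tsupport_scaledKernel_subset hφs x h0).trans (hSK t h0 h1)
  have hχc : ∀ t : ℝ, 0 < t → t ≤ 1 → HasCompactSupport (scaledKernel φ x t) := fun t h0 h1 =>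
    hK.of_isClosed_subset (isClosed_tsupport _) (hχK t h0 h1)
  have hfK : ContinuousOn f K := hfc.mono hKΩ
  set G : ℝ → 𝔽 := fun t => ∫ y in K, scaledKernel φ x t y • f y with hG
  set G' : ℝ → 𝔽 := fun t => ∫ y in K, scaledKernelDeriv φ x t y • f y with hG'
  have hder : ∀ t : ℝ, 0 < t → HasDerivAt G (G' t) t := fun t ht =>
    hasDerivAt_integral_scaledKernel hK hfK hφ x ht
  have hG1 : G 1 = ∫ y in Ω, φ y • f y := by
    have h1 : scaledKernel φ x 1 = φ := by ext y; simp [scaledKernel]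
    have h2 := hχK 1 one_pos le_rfl
    simp only [hG]
    rw [h1] at h2 ⊢
    refine (setIntegral_eq_of_subset_of_forall_sdiff_eq_zero hΩ.measurableSet hKΩ ?_).symm
    intro y hy
    have : φ y = 0 := by
      by_contra h
      exact hy.2 (h2 (subset_tsupport _ h))
    simp [this]
  have hbound : ∀ t : ℝ, 0 < t → t ≤ 1 → ‖G' t‖ ≤ C * t ^ (-(n / p)) := by
    intro t h0 h1
    have hsk : ∀ y, scaledKernelDeriv φ x t y
        = -t⁻¹ * (n * scaledKernel φ x t y + fderiv ℝ (scaledKernel φ x t) y (y - x)) := by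
      intro y
      rw [fderiv_scaledKernel hφ, scaledKernelDeriv, neg_mul]
    have h2 : G' t = ∫ y in Ω, scaledKernelDeriv φ x t y • f y := by
      refine (setIntegral_eq_of_subset_of_forall_sdiff_eq_zero hΩ.measurableSet hKΩ ?_).symm
      intro y hy
      have hy' : y ∉ tsupport (scaledKernel φ x t) := fun h => hy.2 (hχK t h0 h1 h)
      have e1 : scaledKernel φ x t y = 0 := image_eq_zero_of_notMem_tsupport hy'
      have e2 : fderiv ℝ (scaledKernel φ x t) y = 0 :=
        image_eq_zero_of_notMem_tsupport fun h => hy' (tsupport_fderiv_subset ℝ h)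
      simp [hsk, e1, e2]
    have h3 : G' t = t⁻¹ • ∫ y in Ω, scaledKernel φ x t y • Df y (y - x) := by
      rw [h2]
      simp_rw [hsk, mul_smul]
      rw [integral_smul, integral_divergence_smul hΩ hfc hDf hw (contDiff_scaledKernel hφ x t)
        (hχc t h0 h1) ((hχK t h0 h1).trans hKΩ) x, smul_neg, neg_smul, neg_neg]
    have h4 := norm_integral_scaledKernel_smul_le hΩ hDf hp hQ hQΩ hx hρ hcQ hD hI hφs
      (M := M) (fun y => by rw [abs_of_nonneg (hφ0 y)]; exact hM y) h0 h1
    rw [h3, norm_smul, norm_inv, Real.norm_of_nonneg h0.le]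
    calc t⁻¹ * ‖∫ y in Ω, scaledKernel φ x t y • Df y (y - x)‖ ≤ t⁻¹ * (C * t ^ (1 - n / p)) := by
          gcongr
      _ = C * t ^ (-(n / p)) := by
          rw [sub_eq_add_neg, Real.rpow_add h0, Real.rpow_one]
          field_simp
  have hB : ∀ t : ℝ, 0 < t →
      HasDerivAt (fun t : ℝ => C * t ^ (1 - n / p) / (1 - n / p)) (C * t ^ (-(n / p))) t := by
    intro t ht
    have h := ((Real.hasDerivAt_rpow_const (x := t) (p := 1 - n / p)
      (Or.inl ht.ne')).const_mul C).div_const (1 - n / p)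
    refine h.congr_deriv ?_
    rw [show 1 - (n : ℝ) / p - 1 = -(n / p) by ring, mul_left_comm,
      mul_div_cancel_left₀ _ hα.ne']
  have hfence : ∀ ε : ℝ, 0 < ε → ε < 1 → ‖G 1 - G ε‖ ≤ C / (1 - n / p) := by
    intro ε h0 h1
    have hpos : ∀ t ∈ Icc ε 1, 0 < t := fun t ht => h0.trans_le ht.1
    have h := image_norm_le_of_norm_deriv_right_le_deriv_boundary' (a := ε) (b := 1)
      (f := fun t => G t - G ε) (f' := G')
      (B := fun t => C * t ^ (1 - n / p) / (1 - n / p) - C * ε ^ (1 - n / p) / (1 - n / p))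
      (B' := fun t => C * t ^ (-(n / p)))
      (fun t ht => ((hder t (hpos t ht)).sub_const _).continuousAt.continuousWithinAt)
      (fun t ht => ((hder t (hpos t (Ico_subset_Icc_self ht))).sub_const _).hasDerivWithinAt)
      (by simp)
      (fun t ht => ((hB t (hpos t ht)).sub_const _).continuousAt.continuousWithinAt)
      (fun t ht => ((hB t (hpos t (Ico_subset_Icc_self ht))).sub_const _).hasDerivWithinAt)
      (fun t ht => hbound t (hpos t (Ico_subset_Icc_self ht)) ht.2.le)
      (right_mem_Icc.2 h1.le)
    refine h.trans ?_
    have : 0 ≤ C * ε ^ (1 - n / p) / (1 - n / p) := by positivity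
    simp only [Real.one_rpow, mul_one]
    linarith
  have hlim : Tendsto G (𝓝[>] 0) (𝓝 (f x)) := by
    rw [Metric.tendsto_nhds]
    intro η hη
    obtain ⟨δ, hδ, hfδ⟩ := Metric.continuousOn_iff.1 hfc x (hQΩ hx) (η / 2) (by positivity)
    have hpos : 0 < min 1 (δ / (D + 1)) := by positivity
    filter_upwards [Ioo_mem_nhdsGT hpos] with ε hε
    have h0 : 0 < ε := hε.1
    have h1 : ε ≤ 1 := hε.2.le.trans (min_le_left _ _)
    have h2 : ε * (D + 1) < δ := by
      rw [← lt_div_iff₀ (by positivity)]; exact hε.2.trans_le (min_le_right _ _)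
    have hχ0 : ∀ y, 0 ≤ scaledKernel φ x ε y := fun y => mul_nonneg (by positivity) (hφ0 _)
    have hone : ∫ y in K, scaledKernel φ x ε y = 1 := by
      rw [setIntegral_eq_integral_of_forall_compl_eq_zero, integral_scaledKernel φ x h0, hφ1]
      intro y hy
      exact image_eq_zero_of_notMem_tsupport fun h => hy (hχK ε h0 h1 h)
    have hχcont := (contDiff_scaledKernel hφ x ε).continuous
    have hi1 : IntegrableOn (fun y => scaledKernel φ x ε y) K :=
      hχcont.continuousOn.integrableOn_compact hK
    have hi2 : IntegrableOn (fun y => scaledKernel φ x ε y • f y) K :=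
      (hχcont.continuousOn.smul hfK).integrableOn_compact hK
    have hdiff : G ε - f x = ∫ y in K, scaledKernel φ x ε y • (f y - f x) := by
      simp_rw [smul_sub]
      rw [integral_sub hi2 (hi1.smul_const _), integral_smul_const, hone, one_smul]
    rw [dist_eq_norm, hdiff]
    have hle : ‖∫ y in K, scaledKernel φ x ε y • (f y - f x)‖
        ≤ ∫ y in K, scaledKernel φ x ε y * (η / 2) := by
      refine norm_integral_le_of_norm_le (hi1.mul_const _) ?_
      filter_upwards [ae_restrict_mem hK.measurableSet] with y hyK
      rw [norm_smul, Real.norm_of_nonneg (hχ0 y)]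
      by_cases hy : y ∈ tsupport (scaledKernel φ x ε)
      · refine mul_le_mul_of_nonneg_left ?_ (hχ0 y)
        rw [← dist_eq_norm]
        refine (hfδ y (hKΩ hyK) ?_).le
        obtain ⟨z, hz, rfl⟩ := exists_mem_closedBall_of_mem_scaled h0
          (tsupport_scaledKernel_subset hφs x h0 hy)
        rw [dist_eq_norm, add_sub_cancel_left, norm_smul, Real.norm_of_nonneg h0.le]
        have := hD z (hcQ hz)
        nlinarith
      · simp [image_eq_zero_of_notMem_tsupport hy]
    rw [integral_mul_const, hone] at hle
    linarith
  rw [← hG1]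
  refine le_of_tendsto ((tendsto_const_nhds.sub hlim).norm) ?_
  filter_upwards [Ioo_mem_nhdsGT (zero_lt_one' ℝ)] with ε hε
  exact hfence ε hε.1 hε.2

/-- Morrey's inequality on convex sets of controlled eccentricity. -/
lemma exists_morrey {Ω : Set 𝔼} (hΩ : IsOpen Ω) {f : 𝔼 → 𝔽}
    (hfc : ContinuousOn f Ω) {Df : 𝔼 → (𝔼 →L[ℝ] 𝔽)}
    (hDf : LocallyIntegrableOn Df Ω volume)
    (hw : ∀ φ : 𝔼 → ℝ, ContDiff ℝ (⊤ : ℕ∞) φ → HasCompactSupport φ →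
      tsupport φ ⊆ Ω → ∀ v : 𝔼,
        (∫ x in Ω, (fderiv ℝ φ x v) • f x ∂volume) = - ∫ x in Ω, (φ x) • (Df x v) ∂volume)
    {p : ℝ} (hp : 1 < p) (hnp : n < p) :
    ∃ C : ℝ, 0 ≤ C ∧ ∀ (Q : Set 𝔼) (c : 𝔼) (r : ℝ), 0 < r → Convex ℝ Q → Q ⊆ Ω →
      closedBall c (r / 4) ⊆ Q → (∀ y ∈ Q, ∀ z ∈ Q, ‖y - z‖ ≤ n * r) →
      ∫⁻ y in Q, ‖Df y‖ₑ ^ p < ⊤ →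
      ∀ y ∈ Q, ∀ z ∈ Q, ‖f y - f z‖ ≤
        C * r ^ (1 - n / p) * (∫⁻ y in Q, ‖Df y‖ₑ ^ p).toReal ^ (1 / p) := by
  have hp0 : 0 < p := by linarith
  have hα : 0 < 1 - n / p := by rw [sub_pos, div_lt_one hp0]; exact hnp
  set ω := volume.real (ball (0 : 𝔼) 1) with hω
  have hω0 : 0 < ω := ENNReal.toReal_pos (measure_ball_pos _ _ one_pos).ne' measure_ball_lt_top.ne
  have hvol : ∀ (c : 𝔼) (r : ℝ), 0 < r → volume.real (closedBall c r) = r ^ n * ω := by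
    intro c r hr
    rw [measureReal_def, Measure.addHaar_closedBall _ _ hr.le, ENNReal.toReal_mul,
      ENNReal.toReal_ofReal (by positivity)]
    simp [hω, measureReal_def]
  refine ⟨2 * (n * 8 ^ n * ω⁻¹ * (ω / 4 ^ n) ^ (1 - 1 / p) / (1 - n / p)), by positivity, ?_⟩
  intro Q c r hr hQ hQΩ hcQ hdiam hI
  let b : ContDiffBump c := ⟨r / 8, r / 4, by positivity, by linarith⟩
  set A := (∫⁻ y in Q, ‖Df y‖ₑ ^ p).toReal ^ (1 / p) with hA
  have key : ∀ y ∈ Q, ‖(∫ y in Ω, b.normed volume y • f y) - f y‖ ≤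
      (n * 8 ^ n * ω⁻¹ * (ω / 4 ^ n) ^ (1 - 1 / p) / (1 - n / p)) * r ^ (1 - n / p) * A := by
    intro y hy
    have h := norm_sub_integral_smul_le hΩ hfc hDf hw hp hnp hQ hQΩ hy (ρ := r / 4)
      (by positivity) hcQ (D := n * r) (fun z hz => hdiam z hz y hy) hI
      (φ := b.normed volume) b.contDiff_normed b.tsupport_normed_eq.subset
      b.nonneg_normed b.integral_normed
      (b.normed_le_div_measure_closedBall_rIn volume)
    refine h.trans (le_of_eq ?_)
    have hb : b.rIn = r / 8 := rfl
    rw [hb, hvol _ _ (by positivity), hvol _ _ (by positivity), ← hA]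
    have e1 : (r / 4) ^ n * ω = r ^ n * (ω / 4 ^ n) := by rw [div_pow]; ring
    have e2 : r * (r ^ n)⁻¹ * (r ^ n) ^ (1 - 1 / p) = r ^ (1 - n / p) := by
      rw [← Real.rpow_natCast, ← Real.rpow_neg hr.le, ← Real.rpow_mul hr.le]
      nth_rw 1 [← Real.rpow_one r]
      rw [← Real.rpow_add hr, ← Real.rpow_add hr]
      congr 1
      ring
    rw [e1, Real.mul_rpow (by positivity) (by positivity), ← e2, div_pow]
    field_simp
  intro y hy z hz
  have h1 := key y hy
  have h2 := key z hz
  calc ‖f y - f z‖ = ‖((∫ y in Ω, b.normed volume y • f y) - f z)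
          - ((∫ y in Ω, b.normed volume y • f y) - f y)‖ := by congr 1; abel
    _ ≤ _ := norm_sub_le _ _
    _ ≤ _ := by linarith

end Morrey

section Dyadic

variable {n : ℕ}

local notation "𝔼" => EuclideanSpace ℝ (Fin n)

/-- The index of the half-open dyadic cube of side `2⁻ᵏ` containing `x`. -/
def dyadicIndex (k : ℕ) (x : 𝔼) : Fin n → ℤ := fun i => ⌊(2 : ℝ) ^ k * x i⌋

/-- The half-open dyadic cube of side `2⁻ᵏ` and index `z`. -/
def dyadicCube (k : ℕ) (z : Fin n → ℤ) : Set 𝔼 := {y | dyadicIndex k y = z}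

lemma mem_dyadicCube {k : ℕ} {z : Fin n → ℤ} {y : 𝔼} :
    y ∈ dyadicCube k z ↔ ∀ i, (z i : ℝ) ≤ (2 : ℝ) ^ k * y i ∧ (2 : ℝ) ^ k * y i < z i + 1 := by
  simp [dyadicCube, dyadicIndex, funext_iff, Int.floor_eq_iff]

lemma dyadicIndex_eq_of_le {j k : ℕ} (h : j ≤ k) {x y : 𝔼}
    (hxy : dyadicIndex k x = dyadicIndex k y) : dyadicIndex j x = dyadicIndex j y := by
  have key : ∀ (x : 𝔼) (i : Fin n), dyadicIndex j x i = dyadicIndex k x i / (2 ^ (k - j) : ℕ) := by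
    intro x i
    unfold dyadicIndex
    rw [← Int.floor_div_natCast]
    congr 1
    obtain ⟨d, rfl⟩ := Nat.exists_eq_add_of_le h
    simp only [Nat.add_sub_cancel_left, Nat.cast_pow, Nat.cast_ofNat]
    rw [pow_add]
    field_simp
  ext i
  rw [key, key, hxy]

lemma measurableSet_dyadicCube (k : ℕ) (z : Fin n → ℤ) :
    MeasurableSet (dyadicCube k z : Set 𝔼) := by
  have : Measurable (dyadicIndex k : 𝔼 → Fin n → ℤ) := by
    unfold dyadicIndex
    refine measurable_pi_lambda _ fun i => Int.measurable_floor.comp ?_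
    fun_prop
  exact this (measurableSet_singleton z)

lemma convex_dyadicCube (k : ℕ) (z : Fin n → ℤ) : Convex ℝ (dyadicCube k z : Set 𝔼) := by
  intro x hx y hy a b ha hb hab
  rw [mem_dyadicCube] at *
  intro i
  obtain ⟨h1, h2⟩ := hx i
  obtain ⟨h3, h4⟩ := hy i
  have e : (2 : ℝ) ^ k * (a • x + b • y) i = a * (2 ^ k * x i) + b * (2 ^ k * y i) := by
    simp only [PiLp.add_apply, PiLp.smul_apply, smul_eq_mul]
    ring
  rw [e]
  have hb' : b = 1 - a := by linarith
  subst hb'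
  constructor
  · nlinarith
  · rcases ha.eq_or_lt with rfl | ha
    · linarith
    · nlinarith

lemma exists_closedBall_subset_dyadicCube (k : ℕ) (z : Fin n → ℤ) :
    ∃ c : 𝔼, closedBall c ((2 ^ k : ℝ)⁻¹ / 4) ⊆ dyadicCube k z := by
  refine ⟨WithLp.toLp 2 fun i => (2 ^ k : ℝ)⁻¹ * (z i + 1 / 2), fun y hy => ?_⟩
  rw [mem_dyadicCube]
  intro i
  rw [mem_closedBall, dist_eq_norm] at hy
  have h1 := (PiLp.norm_apply_le _ i).trans hy
  simp only [PiLp.sub_apply, Real.norm_eq_abs] at h1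
  have h2 : |(2 : ℝ) ^ k * y i - (z i + 1 / 2)| ≤ 1 / 4 := by
    have e : (2 : ℝ) ^ k * y i - (z i + 1 / 2)
        = 2 ^ k * (y i - (2 ^ k : ℝ)⁻¹ * (z i + 1 / 2)) := by
      field_simp
    rw [e, abs_mul, abs_of_nonneg (by positivity)]
    calc (2 : ℝ) ^ k * |y i - (2 ^ k : ℝ)⁻¹ * (z i + 1 / 2)| ≤ 2 ^ k * ((2 ^ k : ℝ)⁻¹ / 4) := by
          gcongr
      _ = 1 / 4 := by field_simp
  rw [abs_le] at h2
  constructor <;> linarith [h2.1, h2.2]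

lemma norm_le_card_mul_of_forall_abs_le {v : 𝔼} {r : ℝ} (h : ∀ i, |v i| ≤ r) : ‖v‖ ≤ n * r := by
  have hsum : ∑ i, v i • EuclideanSpace.basisFun (Fin n) ℝ i = v := by
    simpa using (EuclideanSpace.basisFun (Fin n) ℝ).sum_repr v
  calc ‖v‖ = ‖∑ i, v i • EuclideanSpace.basisFun (Fin n) ℝ i‖ := by rw [hsum]
    _ ≤ ∑ i, ‖v i • EuclideanSpace.basisFun (Fin n) ℝ i‖ := norm_sum_le _ _
    _ ≤ ∑ _i : Fin n, r := by
        gcongr with i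
        simpa [norm_smul] using h i
    _ = n * r := by simp

lemma norm_sub_le_of_mem_dyadicCube {k : ℕ} {z : Fin n → ℤ} {x y : 𝔼}
    (hx : x ∈ dyadicCube k z) (hy : y ∈ dyadicCube k z) : ‖x - y‖ ≤ n * (2 ^ k : ℝ)⁻¹ := by
  rw [mem_dyadicCube] at hx hy
  refine norm_le_card_mul_of_forall_abs_le fun i => ?_
  obtain ⟨h1, h2⟩ := hx i
  obtain ⟨h3, h4⟩ := hy i
  have hpos : (0 : ℝ) < 2 ^ k := by positivity
  rw [← one_div, le_div_iff₀ hpos, ← abs_of_pos hpos, ← abs_mul, abs_le]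
  simp only [PiLp.sub_apply, sub_mul]
  constructor <;> linarith

open scoped Classical in
/-- A set of finite `ℋˢ` measure is covered by countably many sets, each of which is within one
side length of the reference point of a dyadic cube. -/
lemma exists_dyadic_scales {s : ℝ} (hs : 0 < s) {E : Set 𝔼} (hE : μH[s] E < ⊤) (m : ℕ) :
    ∃ (κ : ℕ → ℕ) (a : ℕ → 𝔼), (∀ i, m ≤ κ i) ∧
      (∀ x ∈ E, ∃ i, ‖x - a i‖ ≤ (2 ^ κ i : ℝ)⁻¹) ∧
      ∑' i, ENNReal.ofReal (2 ^ κ i : ℝ)⁻¹ ^ s ≤ 2 ^ s * (μH[s] E + 2) := by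
  have hr : (0 : ℝ) < (2 ^ m)⁻¹ := by positivity
  have h1 : ⨅ (t : ℕ → Set 𝔼) (_ : E ⊆ ⋃ n, t n)
      (_ : ∀ n, ediam (t n) ≤ ENNReal.ofReal (2 ^ m)⁻¹),
          ∑' n, ⨆ _ : (t n).Nonempty, ediam (t n) ^ s < μH[s] E + 1 := by
    refine lt_of_le_of_lt ?_ (ENNReal.lt_add_right hE.ne one_ne_zero)
    rw [Measure.hausdorffMeasure_apply s E]
    exact le_iSup₂_of_le (ENNReal.ofReal (2 ^ m)⁻¹) (ENNReal.ofReal_pos.2 hr) le_rfl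
  simp only [iInf_lt_iff] at h1
  obtain ⟨t, hEt, htd, hts⟩ := h1
  have hsup : ∀ i, (⨆ _ : (t i).Nonempty, ediam (t i) ^ s) = ediam (t i) ^ s := by
    intro i
    rcases (t i).eq_empty_or_nonempty with h | h
    · simp [h, hs]
    · simp [h]
  simp_rw [hsup] at hts
  obtain ⟨ε, hε0, hε⟩ := ENNReal.exists_pos_sum_of_countable (one_ne_zero : (1 : ℝ≥0∞) ≠ 0) ℕ
  have hfin : ∀ i, ediam (t i) ≠ ⊤ := fun i => ne_top_of_le_ne_top ENNReal.ofReal_ne_top (htd i)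
  let d : ℕ → ℝ := fun i => max (ediam (t i)).toReal (min (2 ^ m)⁻¹ ((ε i : ℝ) ^ (1 / s)))
  have hd0 : ∀ i, 0 < d i := fun i =>
    lt_max_of_lt_right (lt_min hr (Real.rpow_pos_of_pos (hε0 i) _))
  have hdm : ∀ i, d i ≤ (2 ^ m)⁻¹ := fun i =>
    max_le (ENNReal.toReal_le_of_le_ofReal hr.le (htd i)) (min_le_left _ _)
  have hds : ∀ i, ENNReal.ofReal (d i) ^ s ≤ ediam (t i) ^ s + ε i := by
    intro i
    rcases max_choice (ediam (t i)).toReal (min (2 ^ m)⁻¹ ((ε i : ℝ) ^ (1 / s))) with h | h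
    · simp only [d, h, ENNReal.ofReal_toReal (hfin i)]
      exact le_self_add
    · have h2 : d i ≤ (ε i : ℝ) ^ (1 / s) := by
        simp only [d, h]; exact min_le_right _ _
      calc ENNReal.ofReal (d i) ^ s ≤ ENNReal.ofReal ((ε i : ℝ) ^ (1 / s)) ^ s := by gcongr
        _ = ε i := by
          rw [← ENNReal.ofReal_rpow_of_pos (NNReal.coe_pos.2 (hε0 i)), ← ENNReal.rpow_mul, one_div,
            inv_mul_cancel₀ hs.ne', ENNReal.rpow_one, ENNReal.ofReal_coe_nnreal]
        _ ≤ _ := le_add_self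
  have hκ : ∀ i, ∃ k : ℕ, (1 / 2 : ℝ) ^ (k + 1) < d i ∧ d i ≤ (1 / 2 : ℝ) ^ k := fun i =>
    exists_nat_pow_near_of_lt_one (hd0 i)
      ((hdm i).trans (inv_le_one_of_one_le₀ (one_le_pow₀ one_le_two))) (by norm_num) (by norm_num)
  choose κ hκ1 hκ2 using hκ
  refine ⟨κ, fun i => if h : (t i).Nonempty then h.some else 0, fun i => ?_, fun x hx => ?_, ?_⟩
  · have h := (hκ1 i).trans_le (hdm i)
    rw [← inv_pow, ← one_div, pow_lt_pow_iff_right_of_lt_one₀ (by norm_num) (by norm_num)] at h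
    omega
  · obtain ⟨i, hi⟩ := mem_iUnion.1 (hEt hx)
    have hne : (t i).Nonempty := ⟨x, hi⟩
    refine ⟨i, ?_⟩
    simp only [dif_pos hne]
    rw [← dist_eq_norm, ← inv_pow, ← one_div]
    refine le_trans ?_ (hκ2 i)
    refine le_trans ?_ (le_max_left _ _)
    rw [dist_edist]
    exact ENNReal.toReal_mono (hfin i) (edist_le_ediam_of_mem hi hne.some_mem)
  · calc ∑' i, ENNReal.ofReal (2 ^ κ i : ℝ)⁻¹ ^ s
        ≤ ∑' i, 2 ^ s * (ediam (t i) ^ s + ε i) := by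
          refine ENNReal.tsum_le_tsum fun i => ?_
          have h2 : (2 ^ κ i : ℝ)⁻¹ ≤ 2 * d i := by
            have := (hκ1 i).le
            rw [pow_succ, one_div, inv_pow] at this
            linarith
          calc ENNReal.ofReal (2 ^ κ i : ℝ)⁻¹ ^ s ≤ ENNReal.ofReal (2 * d i) ^ s := by gcongr
            _ = 2 ^ s * ENNReal.ofReal (d i) ^ s := by
                rw [ENNReal.ofReal_mul zero_le_two, ENNReal.mul_rpow_of_nonneg _ _ hs.le]
                simp
            _ ≤ _ := by gcongr; exact hds i
      _ = 2 ^ s * (∑' i, ediam (t i) ^ s + ∑' i, (ε i : ℝ≥0∞)) := by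
          rw [ENNReal.tsum_mul_left, ENNReal.tsum_add]
      _ ≤ 2 ^ s * (μH[s] E + 1 + 1) := by gcongr
      _ = 2 ^ s * (μH[s] E + 2) := by rw [add_assoc, one_add_one_eq_two]

lemma exists_shift_dyadicIndex {k : ℕ} {x a : 𝔼} (h : ‖x - a‖ ≤ (2 ^ k : ℝ)⁻¹) :
    ∃ σ : Fin n → Fin 3, dyadicIndex k x = fun i => dyadicIndex k a i + ((σ i : ℕ) : ℤ) - 1 := by
  have key : ∀ i, ∃ u : Fin 3, dyadicIndex k x i = dyadicIndex k a i + ((u : ℕ) : ℤ) - 1 := by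
    intro i
    have h1 : |(2 : ℝ) ^ k * x i - 2 ^ k * a i| ≤ 1 := by
      have h2 := (PiLp.norm_apply_le _ i).trans h
      simp only [PiLp.sub_apply, Real.norm_eq_abs] at h2
      rw [← mul_sub, abs_mul, abs_of_nonneg (by positivity)]
      calc (2 : ℝ) ^ k * |x i - a i| ≤ 2 ^ k * (2 ^ k)⁻¹ := by gcongr
        _ = 1 := by field_simp
    rw [abs_le] at h1
    have h3 : dyadicIndex k x i ≤ dyadicIndex k a i + 1 := by
      unfold dyadicIndex
      rw [← Int.floor_add_one]
      exact Int.floor_le_floor (by linarith [h1.2])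
    have h4 : dyadicIndex k a i ≤ dyadicIndex k x i + 1 := by
      unfold dyadicIndex
      rw [← Int.floor_add_one]
      exact Int.floor_le_floor (by linarith [h1.1])
    refine ⟨⟨(dyadicIndex k x i - dyadicIndex k a i + 1).toNat, by omega⟩, ?_⟩
    simp only
    omega
  choose σ hσ using key
  exact ⟨σ, funext hσ⟩

/-- A set of finite `ℋˢ` measure is covered by disjoint small dyadic cubes, with control on the
sum of the `s`-th powers of the side lengths. -/
lemma exists_disjoint_dyadic_cover {s : ℝ} (hs : 0 < s) {E : Set 𝔼} (hE : μH[s] E < ⊤) (m : ℕ) :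
    ∃ G : Set (ℕ × (Fin n → ℤ)), (∀ q ∈ G, m ≤ q.1) ∧
      (∀ q ∈ G, ∃ x ∈ E, dyadicIndex q.1 x = q.2) ∧
      (Pairwise fun q q' : G => Disjoint (dyadicCube q.1.1 q.1.2 : Set 𝔼)
        (dyadicCube q'.1.1 q'.1.2)) ∧
      (∀ x ∈ E, ∃ q ∈ G, x ∈ (dyadicCube q.1 q.2 : Set 𝔼)) ∧
      ∑' q : G, ENNReal.ofReal (2 ^ q.1.1 : ℝ)⁻¹ ^ s ≤ 3 ^ n * (2 ^ s * (μH[s] E + 2)) := by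
  obtain ⟨κ, a, hκm, hcov, hsum⟩ := exists_dyadic_scales hs hE m
  let Φ : ℕ × (Fin n → Fin 3) → ℕ × (Fin n → ℤ) := fun q =>
    (κ q.1, fun i => dyadicIndex (κ q.1) (a q.1) i + ((q.2 i : ℕ) : ℤ) - 1)
  let levels : 𝔼 → Set ℕ := fun x => {k | (k, dyadicIndex k x) ∈ range Φ}
  have hlev : ∀ x ∈ E, (levels x).Nonempty := by
    intro x hx
    obtain ⟨i, hi⟩ := hcov x hx
    obtain ⟨σ, hσ⟩ := exists_shift_dyadicIndex hi
    exact ⟨κ i, (i, σ), by simp only [Φ, hσ]⟩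
  let lev : 𝔼 → ℕ := fun x => sInf (levels x)
  have hlm : ∀ x ∈ E, lev x ∈ levels x := fun x hx => Nat.sInf_mem (hlev x hx)
  let G : Set (ℕ × (Fin n → ℤ)) := (fun x => (lev x, dyadicIndex (lev x) x)) '' E
  have hGΦ : ∀ q : G, ∃ j, Φ j = q := by
    rintro ⟨_, x, hx, rfl⟩
    exact hlm x hx
  -- two cubes of the family that meet are equal
  have hmeet : ∀ x ∈ E, ∀ x' ∈ E, lev x ≤ lev x' → ∀ y : 𝔼,
      dyadicIndex (lev x) y = dyadicIndex (lev x) x →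
      dyadicIndex (lev x') y = dyadicIndex (lev x') x' →
      (lev x, dyadicIndex (lev x) x) = (lev x', dyadicIndex (lev x') x') := by
    intro x hx x' hx' hle y h1 h2
    have h3 : dyadicIndex (lev x) x' = dyadicIndex (lev x) x :=
      (dyadicIndex_eq_of_le hle h2).symm.trans h1
    have h4 : lev x' ≤ lev x := by
      refine Nat.sInf_le ?_
      change (lev x, dyadicIndex (lev x) x') ∈ range Φ
      rw [h3]
      exact hlm x hx
    have h5 : lev x = lev x' := le_antisymm hle h4
    rw [← h5, h3]
  refine ⟨G, ?_, ?_, ?_, fun x hx => ⟨_, mem_image_of_mem _ hx, rfl⟩, ?_⟩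
  · rintro _ ⟨x, hx, rfl⟩
    obtain ⟨j, hj⟩ := hlm x hx
    have : κ j.1 = lev x := congrArg Prod.fst hj
    exact (hκm j.1).trans_eq this
  · rintro _ ⟨x, hx, rfl⟩
    exact ⟨x, hx, rfl⟩
  · rintro ⟨_, x, hx, rfl⟩ ⟨_, x', hx', rfl⟩ hne
    rw [Set.disjoint_left]
    intro y hy hy'
    refine hne (Subtype.ext ?_)
    rcases le_total (lev x) (lev x') with h | h
    · exact hmeet x hx x' hx' h y hy hy'
    · exact (hmeet x' hx' x hx h y hy' hy).symm
  · choose g hg using hGΦ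
    have hginj : Function.Injective g := fun q q' h => Subtype.ext (by rw [← hg q, ← hg q', h])
    calc ∑' q : G, ENNReal.ofReal (2 ^ q.1.1 : ℝ)⁻¹ ^ s
        = ∑' q : G, (fun j : ℕ × (Fin n → Fin 3) =>
            ENNReal.ofReal (2 ^ (Φ j).1 : ℝ)⁻¹ ^ s) (g q) := by simp only [hg]
      _ ≤ ∑' j : ℕ × (Fin n → Fin 3), ENNReal.ofReal (2 ^ (Φ j).1 : ℝ)⁻¹ ^ s :=
          ENNReal.tsum_comp_le_tsum_of_injective hginj _
      _ = 3 ^ n * ∑' i, ENNReal.ofReal (2 ^ κ i : ℝ)⁻¹ ^ s := by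
          rw [ENNReal.tsum_prod', ← ENNReal.tsum_mul_left]
          simp [Φ, tsum_fintype]
      _ ≤ _ := by gcongr

lemma tsum_rpow_mul_rpow_le {ι : Type*} (f g : ι → ℝ≥0∞) {θ : ℝ} (h0 : 0 ≤ θ) (h1 : θ ≤ 1) :
    ∑' i, f i ^ (1 - θ) * g i ^ θ ≤ (∑' i, f i) ^ (1 - θ) * (∑' i, g i) ^ θ := by
  let _ : MeasurableSpace ι := ⊤
  have h := ENNReal.lintegral_mul_norm_pow_le (μ := Measure.count) (f := f) (g := g)
    (by fun_prop) (by fun_prop) (sub_nonneg.2 h1) h0 (by ring)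
  simpa only [lintegral_count] using h

end Dyadic

section Distortion

variable {n N : ℕ}

local notation "𝔼" => EuclideanSpace ℝ (Fin n)
local notation "𝔽" => EuclideanSpace ℝ (Fin N)

lemma hausdorffMeasure_image_le_of_morrey {Ω U : Set 𝔼} (hUΩ : U ⊆ Ω) {f : 𝔼 → 𝔽} {w : 𝔼 → ℝ≥0∞}
    (hI : ∫⁻ y in Ω, w y < ⊤) {p s : ℝ} (hp : 1 < p) (hnp : n < p) (hs : 0 < s) {C : ℝ}
    (hC : 0 ≤ C)
    (hM : ∀ (k : ℕ) (z : Fin n → ℤ), (dyadicCube k z : Set 𝔼) ⊆ Ω →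
      ∀ x ∈ (dyadicCube k z : Set 𝔼), ∀ y ∈ (dyadicCube k z : Set 𝔼), ‖f x - f y‖ ≤
        C * (2 ^ k : ℝ)⁻¹ ^ (1 - n / p) * (∫⁻ y in dyadicCube k z, w y).toReal ^ (1 / p))
    {E : Set 𝔼} (hE : μH[s] E < ⊤) (m₀ : ℕ)
    (hEU : ∀ x ∈ E, (dyadicCube m₀ (dyadicIndex m₀ x) : Set 𝔼) ⊆ U) :
    μH[p * s / (p - n + s)] (f '' E) ≤ ENNReal.ofReal C ^ (p * s / (p - n + s)) *
      ((3 ^ n * (2 ^ s * (μH[s] E + 2))) ^ (1 - s / (p - n + s)) *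
        (∫⁻ y in U, w y) ^ (s / (p - n + s))) := by
  have hp0 : 0 < p := by linarith
  have hden : 0 < p - n + s := by linarith
  have hα : 0 < 1 - n / p := by rw [sub_pos, div_lt_one hp0]; exact hnp
  set θ := s / (p - n + s) with hθ
  have hθ0 : 0 < θ := by positivity
  have hθ1 : θ ≤ 1 := by rw [hθ, div_le_one hden]; linarith
  have hs' : p * s / (p - n + s) = p * θ := by rw [hθ]; ring
  rw [hs']
  choose G hGm hGE hGd hGc hGs using fun m : ℕ => exists_disjoint_dyadic_cover hs hE (max m m₀)
  have hGU : ∀ m, ∀ q ∈ G m, (dyadicCube q.1 q.2 : Set 𝔼) ⊆ U := by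
    intro m q hq y hy
    obtain ⟨x, hx, hxq⟩ := hGE m q hq
    exact hEU x hx (dyadicIndex_eq_of_le ((le_max_right _ _).trans (hGm m q hq))
      (Eq.trans hy hxq.symm))
  have hdiam : ∀ m, ∀ q ∈ G m, ediam (f '' (dyadicCube q.1 q.2 : Set 𝔼)) ≤
      ENNReal.ofReal C * ENNReal.ofReal (2 ^ q.1 : ℝ)⁻¹ ^ (1 - n / p) *
        (∫⁻ y in dyadicCube q.1 q.2, w y) ^ (1 / p) := by
    intro m q hq
    have hsub := (hGU m q hq).trans hUΩ
    have hfin : ∫⁻ y in dyadicCube q.1 q.2, w y ≠ ⊤ := ((lintegral_mono_set hsub).trans_lt hI).ne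
    refine ediam_le ?_
    rintro _ ⟨x, hx, rfl⟩ _ ⟨y, hy, rfl⟩
    rw [edist_dist, dist_eq_norm]
    refine (ENNReal.ofReal_le_ofReal (hM q.1 q.2 hsub x hx y hy)).trans (le_of_eq ?_)
    rw [ENNReal.ofReal_mul (by positivity), ENNReal.ofReal_mul hC,
      ← ENNReal.ofReal_rpow_of_nonneg (by positivity) hα.le,
      ← ENNReal.ofReal_rpow_of_nonneg (by positivity) (by positivity), ENNReal.ofReal_toReal hfin]
  have hsum : ∀ m, ∑' q : G m, ediam (f '' (dyadicCube q.1.1 q.1.2 : Set 𝔼)) ^ (p * θ) ≤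
      ENNReal.ofReal C ^ (p * θ) * ((3 ^ n * (2 ^ s * (μH[s] E + 2))) ^ (1 - θ) *
        (∫⁻ y in U, w y) ^ θ) := by
    intro m
    calc ∑' q : G m, ediam (f '' (dyadicCube q.1.1 q.1.2 : Set 𝔼)) ^ (p * θ)
        ≤ ∑' q : G m, ENNReal.ofReal C ^ (p * θ) *
          ((ENNReal.ofReal (2 ^ q.1.1 : ℝ)⁻¹ ^ s) ^ (1 - θ) *
            (∫⁻ y in dyadicCube q.1.1 q.1.2, w y) ^ θ) := by
          refine ENNReal.tsum_le_tsum fun q => ?_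
          refine (ENNReal.rpow_le_rpow (hdiam m q.1 q.2) (by positivity)).trans (le_of_eq ?_)
          have hpθ : 0 ≤ p * θ := by positivity
          rw [ENNReal.mul_rpow_of_nonneg _ _ hpθ, ENNReal.mul_rpow_of_nonneg _ _ hpθ,
            ← ENNReal.rpow_mul, ← ENNReal.rpow_mul, ← ENNReal.rpow_mul, mul_assoc]
          have e1 : (1 - n / p) * (p * θ) = s * (1 - θ) := by
            rw [hθ]; field_simp; ring
          have e2 : 1 / p * (p * θ) = θ := by field_simp
          rw [e1, e2]
      _ = ENNReal.ofReal C ^ (p * θ) * ∑' q : G m,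
          (ENNReal.ofReal (2 ^ q.1.1 : ℝ)⁻¹ ^ s) ^ (1 - θ) *
            (∫⁻ y in dyadicCube q.1.1 q.1.2, w y) ^ θ := ENNReal.tsum_mul_left
      _ ≤ ENNReal.ofReal C ^ (p * θ) * ((∑' q : G m, ENNReal.ofReal (2 ^ q.1.1 : ℝ)⁻¹ ^ s) ^ (1 - θ)
          * (∑' q : G m, ∫⁻ y in dyadicCube q.1.1 q.1.2, w y) ^ θ) := by
          gcongr
          exact tsum_rpow_mul_rpow_le _ _ hθ0.le hθ1
      _ ≤ _ := by
          have h1θ : 0 ≤ 1 - θ := by linarith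
          gcongr
          · exact hGs m
          · rw [← lintegral_iUnion (fun q : G m => measurableSet_dyadicCube q.1.1 q.1.2) (hGd m)]
            exact lintegral_mono_set (iUnion_subset fun q => hGU m q.1 q.2)
  let r : ℕ → ℝ≥0∞ := fun m => ENNReal.ofReal C * ENNReal.ofReal (2 ^ m : ℝ)⁻¹ ^ (1 - n / p) *
    (∫⁻ y in Ω, w y) ^ (1 / p)
  have hr : Tendsto r atTop (𝓝 0) := by
    have h1 : Tendsto (fun m : ℕ => (2 ^ m : ℝ)⁻¹) atTop (𝓝 0) := by
      simp_rw [← inv_pow]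
      exact tendsto_pow_atTop_nhds_zero_of_lt_one (by norm_num) (by norm_num)
    have h2 : Tendsto (fun m : ℕ => ENNReal.ofReal (2 ^ m : ℝ)⁻¹ ^ (1 - n / p)) atTop (𝓝 0) := by
      have h := ((ENNReal.continuous_rpow_const (y := 1 - n / p)).tendsto _).comp
        (ENNReal.tendsto_ofReal h1)
      rw [ENNReal.ofReal_zero, ENNReal.zero_rpow_of_pos hα] at h
      exact h
    have h3 := ENNReal.Tendsto.mul_const (b := (∫⁻ y in Ω, w y) ^ (1 / p))
      (ENNReal.Tendsto.const_mul (a := ENNReal.ofReal C) h2 (Or.inr ENNReal.ofReal_ne_top))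
      (Or.inr (ENNReal.rpow_ne_top_of_nonneg (by positivity) hI.ne))
    rw [mul_zero, zero_mul] at h3
    exact h3
  refine (Measure.hausdorffMeasure_le_liminf_tsum (ι := fun m => G m) (p * θ) (f '' E) (l := atTop)
    r hr (fun m q => f '' (dyadicCube q.1.1 q.1.2 : Set 𝔼)) ?_ ?_).trans ?_
  · refine Eventually.of_forall fun m q => (hdiam m q.1 q.2).trans ?_
    have h1 : (2 ^ q.1.1 : ℝ)⁻¹ ≤ (2 ^ m : ℝ)⁻¹ := by
      gcongr
      · exact one_le_two
      · exact (le_max_left _ _).trans (hGm m q.1 q.2)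
    simp only [r]
    gcongr
    exact (hGU m q.1 q.2).trans hUΩ
  · refine Eventually.of_forall fun m => ?_
    rintro _ ⟨x, hx, rfl⟩
    obtain ⟨q, hq, hxq⟩ := hGc m x hx
    exact mem_iUnion.2 ⟨⟨q, hq⟩, mem_image_of_mem f hxq⟩
  · exact (liminf_le_liminf (Eventually.of_forall hsum)).trans (liminf_const _).le

lemma volume_eq_zero_of_hausdorffMeasure_lt_top {s : ℝ} (hsn : s < n) {E : Set 𝔼}
    (hE : μH[s] E < ⊤) : volume E = 0 := by
  have h0 : μH[(n : ℝ)] E = 0 :=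
    (Measure.hausdorffMeasure_zero_or_top hsn E).resolve_right hE.ne
  have hH : Measure.IsAddHaarMeasure (μH[(n : ℝ)] : Measure 𝔼) := by
    simpa using MeasureTheory.isAddHaarMeasure_hausdorffMeasure (E := EuclideanSpace ℝ (Fin n))
  exact Measure.absolutelyContinuous_isAddHaarMeasure volume μH[(n : ℝ)] h0

lemma hausdorffMeasure_image_eq_zero_of_morrey {Ω : Set 𝔼} (hΩ : IsOpen Ω) {f : 𝔼 → 𝔽}
    {w : 𝔼 → ℝ≥0∞} (hI : ∫⁻ y in Ω, w y < ⊤) {p s : ℝ} (hp : 1 < p) (hnp : n < p) (hs : 0 < s)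
    (hsn : s < n) {C : ℝ} (hC : 0 ≤ C)
    (hM : ∀ (k : ℕ) (z : Fin n → ℤ), (dyadicCube k z : Set 𝔼) ⊆ Ω →
      ∀ x ∈ (dyadicCube k z : Set 𝔼), ∀ y ∈ (dyadicCube k z : Set 𝔼), ‖f x - f y‖ ≤
        C * (2 ^ k : ℝ)⁻¹ ^ (1 - n / p) * (∫⁻ y in dyadicCube k z, w y).toReal ^ (1 / p))
    {E : Set 𝔼} (hEΩ : E ⊆ Ω) (hE : μH[s] E < ⊤) :
    μH[p * s / (p - n + s)] (f '' E) = 0 := by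
  have hp0 : 0 < p := by linarith
  have hden : 0 < p - n + s := by linarith
  set θ := s / (p - n + s) with hθ
  have hθ0 : 0 < θ := by positivity
  have hθ1 : 0 ≤ 1 - θ := by rw [hθ, sub_nonneg, div_le_one hden]; linarith
  set B := ENNReal.ofReal C ^ (p * s / (p - n + s)) *
    (3 ^ n * (2 ^ s * (μH[s] E + 2))) ^ (1 - θ) with hB
  have hBtop : B ≠ ⊤ := by
    refine ENNReal.mul_ne_top (ENNReal.rpow_ne_top_of_nonneg (by positivity) ENNReal.ofReal_ne_top)
      (ENNReal.rpow_ne_top_of_nonneg hθ1 (ENNReal.mul_ne_top (by simp)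
        (ENNReal.mul_ne_top (ENNReal.rpow_ne_top_of_nonneg hs.le (by simp)) ?_)))
    exact ENNReal.add_ne_top.2 ⟨hE.ne, by simp⟩
  have key : ∀ ε : ℝ≥0∞, 0 < ε → μH[p * s / (p - n + s)] (f '' E) ≤ B * ε ^ θ := by
    intro ε hε
    let ν : Measure 𝔼 := (volume.restrict Ω).withDensity w
    have : IsFiniteMeasure ν := isFiniteMeasure_withDensity hI.ne
    have hνE : ν E = 0 := by
      refine withDensity_absolutelyContinuous _ _ ?_
      exact Measure.absolutelyContinuous_of_le Measure.restrict_le_self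
        (volume_eq_zero_of_hausdorffMeasure_lt_top hsn hE)
    obtain ⟨V, hEV, hV, hνV⟩ := E.exists_isOpen_lt_of_lt (μ := ν) ε (by rwa [hνE])
    have hνU : ∫⁻ y in V ∩ Ω, w y < ε := by
      rwa [withDensity_apply _ hV.measurableSet, Measure.restrict_restrict hV.measurableSet] at hνV
    let F : ℕ → Set 𝔼 := fun m => {x ∈ E | (dyadicCube m (dyadicIndex m x) : Set 𝔼) ⊆ V ∩ Ω}
    have hFmono : Monotone F := fun j k hjk x hx =>
      ⟨hx.1, fun y hy => hx.2 (dyadicIndex_eq_of_le hjk hy)⟩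
    have hFE : ⋃ m, F m = E := by
      refine Subset.antisymm (iUnion_subset fun m => sep_subset _ _) fun x hx => ?_
      obtain ⟨δ, hδ, hball⟩ := Metric.isOpen_iff.1 (hV.inter hΩ) x ⟨hEV hx, hEΩ hx⟩
      obtain ⟨m, hm⟩ := exists_pow_lt_of_lt_one (show 0 < δ / (n + 1) by positivity)
        (show (1 / 2 : ℝ) < 1 by norm_num)
      refine mem_iUnion.2 ⟨m, hx, fun y hy => hball ?_⟩
      rw [mem_ball, dist_eq_norm]
      have h1 := norm_sub_le_of_mem_dyadicCube hy (show x ∈ dyadicCube m (dyadicIndex m x) from rfl)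
      rw [one_div, inv_pow, lt_div_iff₀ (by positivity)] at hm
      have h2 : (0 : ℝ) < (2 ^ m)⁻¹ := by positivity
      nlinarith
    have hmono : Monotone fun m => f '' F m := fun j k hjk => image_mono (hFmono hjk)
    rw [← hFE, image_iUnion, hmono.measure_iUnion]
    refine iSup_le fun m => ?_
    have hFm : μH[s] (F m) ≤ μH[s] E := measure_mono (sep_subset _ _)
    refine (hausdorffMeasure_image_le_of_morrey inter_subset_right hI hp hnp hs hC hM
      (hFm.trans_lt hE) m fun x hx => hx.2).trans ?_
    rw [hB, mul_assoc]
    gcongr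
  have hlim : Tendsto (fun ε : ℝ≥0∞ => B * ε ^ θ) (𝓝[>] 0) (𝓝 0) := by
    have h1 : Tendsto (fun ε : ℝ≥0∞ => ε ^ θ) (𝓝[>] 0) (𝓝 0) := by
      have h := (ENNReal.continuous_rpow_const (y := θ)).tendsto 0
      rw [ENNReal.zero_rpow_of_pos hθ0] at h
      exact h.mono_left nhdsWithin_le_nhds
    simpa using ENNReal.Tendsto.const_mul (a := B) h1 (Or.inr hBtop)
  refine le_antisymm (ge_of_tendsto hlim ?_) zero_le
  filter_upwards [self_mem_nhdsWithin] with ε hε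
  exact key ε hε

end Distortion

/-- Kaufman: Hausdorff dimension distortion under continuous supercritical Sobolev
maps: if `E` has σ-finite `ℋ^s` measure, `s ∈ (0,n)`, then `ℋ^{s'}(f(E)) = 0` for
`s' = ps/(p-n+s)`; in particular `dimH f(E) ≤ p·dimH E/(p - n + dimH E)`. -/
theorem kaufman_sobolev_dim_distortion (n N : ℕ) (Ω : Set (EuclideanSpace ℝ (Fin n)))
    (hΩ : IsEuclDomain Ω) (p : ℝ) (hp : (n : ℝ) < p)
    (f : EuclideanSpace ℝ (Fin n) → EuclideanSpace ℝ (Fin N))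
    (hfc : ContinuousOn f Ω) (hf : MemW1p n N p Ω f) :
    (∀ s : ℝ, 0 < s → s < n → ∀ E ⊆ Ω,
      (∃ F : ℕ → Set (EuclideanSpace ℝ (Fin n)), E = ⋃ i, F i ∧ ∀ i, μH[s] (F i) < ⊤) →
      μH[p*s/(p - n + s)] (f '' E) = 0) ∧
    (∀ E ⊆ Ω, 0 < dimH E → dimH E < (n : ℝ≥0∞) →
      dimH (f '' E) ≤
        ENNReal.ofReal (p * (dimH E).toReal / (p - n + (dimH E).toReal))) := by
  have hzero : ∀ s : ℝ, 0 < s → s < n → ∀ E ⊆ Ω, μH[s] E < ⊤ →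
      μH[p * s / (p - n + s)] (f '' E) = 0 := by
    intro s hs hsn E hE hEfin
    obtain ⟨Df, hDf, hDfp, hw⟩ := hf
    have hn : (1 : ℝ) ≤ n := by
      have : 0 < n := by exact_mod_cast hs.trans hsn
      exact_mod_cast this
    have hp1 : 1 < p := hn.trans_lt hp
    obtain ⟨C, hC, hM⟩ := exists_morrey hΩ.1 hfc hDf hw hp1 hp
    have hI : ∫⁻ y in Ω, ‖Df y‖ₑ ^ p < ⊤ := by
      refine lt_of_le_of_lt (lintegral_mono fun y => ?_) hDfp
      rw [← ofReal_norm, ENNReal.ofReal_rpow_of_nonneg (norm_nonneg _) (by linarith)]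
    refine hausdorffMeasure_image_eq_zero_of_morrey hΩ.1 hI hp1 hp hs hsn hC ?_ hE hEfin
    intro k z hsub
    obtain ⟨c, hc⟩ := exists_closedBall_subset_dyadicCube k z
    exact hM (dyadicCube k z) c (2 ^ k : ℝ)⁻¹ (by positivity) (convex_dyadicCube k z) hsub hc
      (fun y hy z hz => norm_sub_le_of_mem_dyadicCube hy hz)
      ((lintegral_mono_set hsub).trans_lt hI)
  refine ⟨?_, ?_⟩
  · rintro s hs hsn E hE ⟨F, rfl, hF⟩
    rw [image_iUnion, measure_iUnion_null_iff]
    exact fun i => hzero s hs hsn (F i) ((subset_iUnion F i).trans hE) (hF i)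
  · intro E hE hd0 hdn
    have hdtop : dimH E ≠ ⊤ := (hdn.trans (ENNReal.natCast_lt_top n)).ne
    set d := (dimH E).toReal with hd
    have hdpos : 0 < d := ENNReal.toReal_pos hd0.ne' hdtop
    have hdlt : d < n := by
      rw [hd, ← ENNReal.toReal_natCast]
      exact ENNReal.toReal_strict_mono (ENNReal.natCast_ne_top n) hdn
    have hlim : Tendsto (fun s : ℝ => ENNReal.ofReal (p * s / (p - n + s))) (𝓝[>] d)
        (𝓝 (ENNReal.ofReal (p * d / (p - n + d)))) := by
      refine ENNReal.tendsto_ofReal (Tendsto.mono_left (ContinuousAt.tendsto ?_) nhdsWithin_le_nhds)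
      refine ContinuousAt.div (by fun_prop) (by fun_prop) ?_
      linarith
    refine ge_of_tendsto hlim ?_
    filter_upwards [Ioo_mem_nhdsGT hdlt] with s hs
    have hs0 : 0 < s := hdpos.trans hs.1
    have hE0 : μH[(s.toNNReal : ℝ)] E = 0 := by
      refine hausdorffMeasure_of_dimH_lt ?_
      rw [← ENNReal.ofReal_toReal hdtop]
      exact (ENNReal.ofReal_lt_ofReal_iff hs0).2 hs.1
    rw [Real.coe_toNNReal _ hs0.le] at hE0
    have h := hzero s hs0 hs.2 E hE (hE0.trans_lt ENNReal.zero_lt_top)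
    have hn0 : (0 : ℝ) ≤ n := n.cast_nonneg
    have hs' : 0 ≤ p * s / (p - n + s) :=
      div_nonneg (mul_nonneg (by linarith) hs0.le) (by linarith)
    refine dimH_le_of_hausdorffMeasure_ne_top (d := (p * s / (p - n + s)).toNNReal) ?_
    rw [Real.coe_toNNReal _ hs']
    exact h.trans_ne ENNReal.zero_ne_top
end
end

section
/- Let E ⊆ ℝ^n be a closed set with dimH E ≥ s for some 0 < s ≤ n, and let p > n. Then there exists a continuous map f ∈ W^{1,p}(ℝ^n : ℝ^n) such that dimH f(E) ≥ ps/(p−n+s). -/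
open Set Filter MeasureTheory Metric Topology
open scoped ENNReal NNReal

noncomputable section

/-- A finite measure on a Borel set `A` whose push-forward under `f` has finite `α`-energy forces
`dimH (f '' A) ≥ α`. -/
theorem le_dimH_image_of_lintegral_edist_rpow_ne_top {X Y : Type*} [MeasurableSpace X]
    [TopologicalSpace X] [BorelSpace X] [MetricSpace Y] [MeasurableSpace Y] [BorelSpace Y]
    [SecondCountableTopology Y] {f : X → Y} (hf : Continuous f) {A : Set X} (hA : MeasurableSet A)
    (μ : Measure X) [IsFiniteMeasure μ] (hμA : μ A ≠ 0) {α : ℝ} (hα : 0 < α)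
    (hE : ∫⁻ x, ∫⁻ y, edist (f x) (f y) ^ (-α) ∂μ ∂μ ≠ ∞) :
    ENNReal.ofReal α ≤ dimH (f '' A) := by
  have hmeas : Measurable (Function.uncurry fun x y : X => edist (f x) (f y) ^ (-α)) := by
    have h1 : Measurable fun z : X × X => edist (f z.1) (f z.2) :=
      (hf.measurable.comp measurable_fst).edist (hf.measurable.comp measurable_snd)
    exact h1.pow_const _
  set u : X → ℝ≥0∞ := fun x => ∫⁻ y, edist (f x) (f y) ^ (-α) ∂μ with hu
  have hum : Measurable u := hmeas.lintegral_prod_right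
  have hufin : ∀ᵐ x ∂μ, u x < ∞ := ae_lt_top hum hE
  obtain ⟨N, hN⟩ : ∃ N : ℕ, μ (A ∩ {x | u x ≤ N}) ≠ 0 := by
    by_contra! h
    apply hμA
    have h1 : μ (⋃ N : ℕ, A ∩ {x | u x ≤ N}) = 0 := measure_iUnion_null h
    refine measure_mono_null (t := (⋃ N : ℕ, A ∩ {x | u x ≤ N}) ∪ {x | ¬ u x < ∞}) ?_
      (measure_union_null h1 hufin)
    intro x hx
    by_cases hx' : u x < ∞
    · obtain ⟨N, hN⟩ := ENNReal.exists_nat_gt hx'.ne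
      exact Or.inl (mem_iUnion.2 ⟨N, hx, hN.le⟩)
    · exact Or.inr hx'
  set G : Set X := A ∩ {x | u x ≤ N} with hG
  have hGm : MeasurableSet G := hA.inter (measurableSet_le hum measurable_const)
  have key : ∀ x ∈ G, ∀ d : ℝ≥0∞, μ (f ⁻¹' closedEBall (f x) d) ≤ (N + 1 : ℝ≥0∞) * d ^ α := by
    intro x hx d
    have hB : MeasurableSet (f ⁻¹' closedEBall (f x) d) :=
      (isClosed_closedEBall.preimage hf).measurableSet
    have h1 : d ^ (-α) * μ (f ⁻¹' closedEBall (f x) d) ≤ N := by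
      calc d ^ (-α) * μ (f ⁻¹' closedEBall (f x) d)
          = ∫⁻ _ in f ⁻¹' closedEBall (f x) d, d ^ (-α) ∂μ := by simp
        _ ≤ ∫⁻ y in f ⁻¹' closedEBall (f x) d, edist (f x) (f y) ^ (-α) ∂μ := by
            refine setLIntegral_mono' hB fun y hy => ?_
            rw [ENNReal.rpow_neg, ENNReal.rpow_neg]
            refine ENNReal.inv_le_inv.2 (ENNReal.rpow_le_rpow ?_ hα.le)
            rw [edist_comm]; exact hy
        _ ≤ u x := setLIntegral_le_lintegral _ _
        _ ≤ N := hx.2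
    rcases eq_or_ne d 0 with rfl | hd0
    · rw [ENNReal.zero_rpow_of_neg (by linarith)] at h1
      have : μ (f ⁻¹' closedEBall (f x) 0) = 0 := by
        by_contra h
        rw [ENNReal.top_mul h] at h1
        simp at h1
      rw [this]; exact bot_le
    rcases eq_or_ne d ∞ with rfl | hdt
    · rw [ENNReal.top_rpow_of_pos hα, ENNReal.mul_top (by positivity)]
      exact le_top
    rw [ENNReal.rpow_neg, mul_comm, ← div_eq_mul_inv] at h1
    rw [ENNReal.div_le_iff (by simp [hd0, hdt]) (ENNReal.rpow_ne_top_of_nonneg hα.le hdt)] at h1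
    exact h1.trans (by gcongr; exact le_self_add)
  set ν : Measure Y := ((N + 1 : ℝ≥0∞)⁻¹) • (μ.restrict G).map f with hν
  have hνle : ν ≤ μH[α] := by
    refine Measure.le_hausdorffMeasure α ν 1 one_pos fun s _ => ?_
    rw [← ediam_closure s]
    refine (measure_mono subset_closure).trans ?_
    rcases (f ⁻¹' closure s ∩ G).eq_empty_or_nonempty with h | ⟨x, hs, hx⟩
    · rw [hν, Measure.smul_apply, Measure.map_apply hf.measurable isClosed_closure.measurableSet,
        Measure.restrict_apply (isClosed_closure.measurableSet.preimage hf.measurable), h]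
      simp
    · have hsub : closure s ⊆ closedEBall (f x) (ediam (closure s)) :=
        fun y hy => edist_le_ediam_of_mem hy hs
      calc ν (closure s) ≤ ν (closedEBall (f x) (ediam (closure s))) := measure_mono hsub
        _ = (N + 1 : ℝ≥0∞)⁻¹ * (μ.restrict G) (f ⁻¹' closedEBall (f x) (ediam (closure s))) := by
            rw [hν, Measure.smul_apply, smul_eq_mul,
              Measure.map_apply hf.measurable isClosed_closedEBall.measurableSet]
        _ ≤ (N + 1 : ℝ≥0∞)⁻¹ * ((N + 1 : ℝ≥0∞) * ediam (closure s) ^ α) := by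
            gcongr
            exact (Measure.restrict_apply_le _ _).trans (key x hx _)
        _ = ediam (closure s) ^ α := by
            rw [← mul_assoc, ENNReal.inv_mul_cancel (by positivity) (by finiteness), one_mul]
  have hpos : μH[α] (f '' A) ≠ 0 := by
    intro h0
    have h1 : ν (f '' A) = 0 := le_antisymm ((hνle _).trans h0.le) bot_le
    rw [hν, Measure.smul_apply, smul_eq_mul, mul_eq_zero] at h1
    rcases h1 with h1 | h1
    · rw [ENNReal.inv_eq_zero] at h1
      exact absurd h1 (by finiteness)
    · have h2 := Measure.preimage_null_of_map_null hf.aemeasurable h1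
      rw [Measure.restrict_apply' hGm] at h2
      exact hN (measure_mono_null (fun x (hx : x ∈ G) =>
        (⟨mem_image_of_mem f hx.1, hx⟩ : x ∈ f ⁻¹' (f '' A) ∩ G)) h2)
  have := le_dimH_of_hausdorffMeasure_ne_zero (s := f '' A) (d := α.toNNReal)
    (by rwa [Real.coe_toNNReal _ hα.le])
  exact this

theorem lintegral_closedBall_enorm_smul_add_rpow_le (n : ℕ) {α : ℝ} (hα : 0 < α) (hαn : α < n) :
    ∃ C : ℝ≥0∞, C ≠ 0 ∧ C ≠ ∞ ∧ ∀ (c : ℝ) (v : EuclideanSpace ℝ (Fin n)),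
      ∫⁻ t in closedBall (0 : EuclideanSpace ℝ (Fin n)) 1, ‖c • t + v‖ₑ ^ (-α) ≤
        C * ‖c‖ₑ ^ (-α) := by
  have hn : 1 ≤ n := by
    rcases Nat.eq_zero_or_pos n with rfl | h
    · simp at hαn; linarith
    · exact h
  set B : Set (EuclideanSpace ℝ (Fin n)) := closedBall 0 1
  set I : ℝ≥0∞ := ∫⁻ u in B, ‖u‖ₑ ^ (-α) with hI
  have hIfin : I ≠ ∞ := by
    have h1 : IntegrableOn (fun u : EuclideanSpace ℝ (Fin n) => ‖u‖ ^ (-α)) (ball 0 2) volume := by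
      refine integrableOn_ball_of_norm_le_rpow (C := 1) (α := α) (by simpa using hn)
        (by simpa using hαn) ?_ ?_
      · refine Eventually.of_forall fun x => ?_
        rw [one_mul, Real.norm_of_nonneg (by positivity)]
      · exact (measurable_norm.pow_const _).aestronglyMeasurable
    have h2 := (h1.mono_set (closedBall_subset_ball (by norm_num : (1:ℝ) < 2))).2
    rw [hasFiniteIntegral_iff_enorm] at h2
    rw [hI]
    refine ne_of_lt (lt_of_le_of_lt (lintegral_mono_ae ?_) h2)
    have h0 : ∀ᵐ u ∂(volume.restrict B), u ≠ 0 := by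
      have : Nonempty (Fin n) := ⟨⟨0, hn⟩⟩
      exact ae_restrict_of_ae (Measure.ae_ne volume 0)
    filter_upwards [h0] with u hu
    rw [Real.enorm_eq_ofReal (by positivity), ← ENNReal.ofReal_rpow_of_pos (norm_pos_iff.2 hu),
      ofReal_norm]
  have hBpos : volume B ≠ 0 := (measure_closedBall_pos _ _ one_pos).ne'
  have hBfin : volume B ≠ ∞ := measure_closedBall_lt_top.ne
  refine ⟨volume B + I, by simp [hBpos], by simp [hBfin, hIfin], fun c v => ?_⟩
  rcases eq_or_ne c 0 with rfl | hc
  · rw [enorm_zero, ENNReal.zero_rpow_of_neg (by linarith), ENNReal.mul_top (by simp [hBpos])]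
    exact le_top
  set w := c⁻¹ • v
  have hcv : ∀ t : EuclideanSpace ℝ (Fin n), ‖c • t + v‖ₑ ^ (-α) =
      ‖c‖ₑ ^ (-α) * ‖t + w‖ₑ ^ (-α) := by
    intro t
    have : c • t + v = c • (t + w) := by simp [w, smul_add, smul_smul, hc]
    rw [this, enorm_smul, ENNReal.mul_rpow_of_ne_top (by simp) (by simp)]
  have hm : ∀ w : EuclideanSpace ℝ (Fin n), Measurable
      fun t : EuclideanSpace ℝ (Fin n) => ‖t + w‖ₑ ^ (-α) := fun w =>
    (measurable_id.add_const w).enorm.pow_const _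
  simp_rw [hcv]
  rw [lintegral_const_mul _ (hm w), mul_comm]
  gcongr
  have hpt : ∀ t, ‖t + w‖ₑ ^ (-α) ≤ 1 + B.indicator (fun u => ‖u‖ₑ ^ (-α)) (t + w) := by
    intro t
    by_cases ht : t + w ∈ B
    · rw [indicator_of_mem ht]; exact le_add_self
    · rw [indicator_of_notMem ht, add_zero, ENNReal.rpow_neg]
      refine ENNReal.inv_le_one.2 (ENNReal.one_le_rpow ?_ hα)
      have : 1 < ‖t + w‖ := by simpa [B] using ht
      rw [← ofReal_norm]; exact ENNReal.one_le_ofReal.2 this.le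
  calc ∫⁻ t in B, ‖t + w‖ₑ ^ (-α)
      ≤ ∫⁻ t in B, (1 + B.indicator (fun u => ‖u‖ₑ ^ (-α)) (t + w)) := lintegral_mono hpt
    _ = volume B + ∫⁻ t in B, B.indicator (fun u => ‖u‖ₑ ^ (-α)) (t + w) := by
        rw [lintegral_add_left measurable_const]; simp
    _ ≤ volume B + ∫⁻ t, B.indicator (fun u => ‖u‖ₑ ^ (-α)) (t + w) := by
        exact add_le_add le_rfl (setLIntegral_le_lintegral _ _)
    _ = volume B + I := by
        rw [lintegral_add_right_eq_self (fun t => B.indicator (fun u => ‖u‖ₑ ^ (-α)) t) w,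
          lintegral_indicator measurableSet_closedBall]

theorem lintegral_infinitePi_update {ι : Type*} [DecidableEq ι] {X : ι → Type*}
    [∀ i, MeasurableSpace (X i)] (μ : ∀ i, Measure (X i)) [∀ i, IsProbabilityMeasure (μ i)]
    (j : ι) {F : (∀ i, X i) → ℝ≥0∞} (hF : Measurable F) :
    ∫⁻ ξ, F ξ ∂Measure.infinitePi μ =
      ∫⁻ ξ, ∫⁻ t, F (Function.update ξ j t) ∂μ j ∂Measure.infinitePi μ := by
  have hm : Measurable fun z : (∀ i, X i) × X j => Function.update z.1 j z.2 := by
    rw [measurable_pi_iff]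
    intro i
    rcases eq_or_ne i j with rfl | h
    · simpa using measurable_snd
    · simp only [Function.update_of_ne h]
      exact (measurable_pi_apply i).comp measurable_fst
  have hmap : ((Measure.infinitePi μ).prod (μ j)).map
      (fun z : (∀ i, X i) × X j => Function.update z.1 j z.2) = Measure.infinitePi μ := by
    refine Measure.eq_infinitePi μ fun s t ht => ?_
    have hs : MeasurableSet (Set.pi (s : Set ι) t) :=
      MeasurableSet.pi s.countable_toSet fun i _ => ht i
    rw [Measure.map_apply hm hs]
    by_cases hj : j ∈ s
    · have : (fun z : (∀ i, X i) × X j => Function.update z.1 j z.2) ⁻¹' Set.pi (s : Set ι) t =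
          Set.pi ((s.erase j : Finset ι) : Set ι) t ×ˢ t j := by
        ext ⟨ξ, a⟩
        simp only [mem_preimage, Set.mem_pi, mem_prod, Finset.mem_coe, Finset.mem_erase]
        constructor
        · intro h
          refine ⟨fun i hi => ?_, ?_⟩
          · simpa [hi.1] using h i hi.2
          · simpa using h j hj
        · rintro ⟨h1, h2⟩ i hi
          rcases eq_or_ne i j with rfl | hij
          · simpa using h2
          · simpa [hij] using h1 i ⟨hij, hi⟩
      rw [this, Measure.prod_prod, Measure.infinitePi_pi μ (fun i _ => ht i),
        Finset.prod_erase_mul s _ hj]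
    · have : (fun z : (∀ i, X i) × X j => Function.update z.1 j z.2) ⁻¹' Set.pi (s : Set ι) t =
          Set.pi (s : Set ι) t ×ˢ univ := by
        ext ⟨ξ, a⟩
        simp only [mem_preimage, Set.mem_pi, mem_prod, Finset.mem_coe, mem_univ, and_true]
        refine forall₂_congr fun i hi => ?_
        have hij : i ≠ j := fun h => hj (h ▸ hi)
        simp [hij]
      rw [this, Measure.prod_prod, Measure.infinitePi_pi μ (fun i _ => ht i), measure_univ, mul_one]
  conv_lhs => rw [← hmap]
  rw [lintegral_map hF hm]
  exact lintegral_prod _ (hF.comp hm).aemeasurable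

section RandomSeries

variable {n : ℕ} {J : Type*}

/-- The series `∑ g_j(x) ξ_j` with vector coefficients in the closed unit ball. -/
def vectorSeries (g : J → EuclideanSpace ℝ (Fin n) → ℝ)
    (ξ : J → closedBall (0 : EuclideanSpace ℝ (Fin n)) 1) (x : EuclideanSpace ℝ (Fin n)) :
    EuclideanSpace ℝ (Fin n) :=
  ∑' j, g j x • (ξ j : EuclideanSpace ℝ (Fin n))

theorem norm_coe_closedBall_le (t : closedBall (0 : EuclideanSpace ℝ (Fin n)) 1) :
    ‖(t : EuclideanSpace ℝ (Fin n))‖ ≤ 1 :=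
  mem_closedBall_zero_iff.1 t.2

theorem norm_smul_closedBall_le (c : ℝ) (t : closedBall (0 : EuclideanSpace ℝ (Fin n)) 1) :
    ‖c • (t : EuclideanSpace ℝ (Fin n))‖ ≤ ‖c‖ := by
  rw [norm_smul]
  exact mul_le_of_le_one_right (norm_nonneg _) (norm_coe_closedBall_le t)

theorem summable_vectorSeries {g : J → EuclideanSpace ℝ (Fin n) → ℝ} {b : J → ℝ}
    (hb : Summable b) (hgb : ∀ j x, ‖g j x‖ ≤ b j)
    (ξ : J → closedBall (0 : EuclideanSpace ℝ (Fin n)) 1) (x : EuclideanSpace ℝ (Fin n)) :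
    Summable fun j => g j x • (ξ j : EuclideanSpace ℝ (Fin n)) :=
  Summable.of_norm_bounded hb fun j => (norm_smul_closedBall_le _ _).trans (hgb j x)

theorem continuous_vectorSeries {g : J → EuclideanSpace ℝ (Fin n) → ℝ} {b : J → ℝ}
    (hb : Summable b) (hgb : ∀ j x, ‖g j x‖ ≤ b j) (hg : ∀ j, Continuous (g j)) :
    Continuous fun z : (J → closedBall (0 : EuclideanSpace ℝ (Fin n)) 1) ×
      EuclideanSpace ℝ (Fin n) => vectorSeries g z.1 z.2 := by
  refine continuous_tsum (fun j => ?_) hb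
    (fun j z => (norm_smul_closedBall_le _ _).trans (hgb j z.2))
  exact ((hg j).comp continuous_snd).smul
    (continuous_subtype_val.comp ((continuous_apply j).comp continuous_fst))

theorem vectorSeries_update [DecidableEq J] {g : J → EuclideanSpace ℝ (Fin n) → ℝ} {b : J → ℝ}
    (hb : Summable b) (hgb : ∀ j x, ‖g j x‖ ≤ b j)
    (ξ : J → closedBall (0 : EuclideanSpace ℝ (Fin n)) 1) (x : EuclideanSpace ℝ (Fin n)) (j : J)
    (t : closedBall (0 : EuclideanSpace ℝ (Fin n)) 1) :
    vectorSeries g (Function.update ξ j t) x =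
      g j x • (t : EuclideanSpace ℝ (Fin n)) - g j x • (ξ j : EuclideanSpace ℝ (Fin n))
        + vectorSeries g ξ x := by
  have h := (summable_vectorSeries hb hgb ξ x).hasSum.update j
    (g j x • (t : EuclideanSpace ℝ (Fin n)))
  refine Eq.trans (tsum_congr fun i => ?_) h.tsum_eq
  rcases eq_or_ne i j with rfl | hij
  · simp
  · simp [hij]

/-- The uniform probability measure on the closed unit ball. -/
def uniformBall (n : ℕ) : Measure (closedBall (0 : EuclideanSpace ℝ (Fin n)) 1) :=
  (volume (closedBall (0 : EuclideanSpace ℝ (Fin n)) 1))⁻¹ •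
    Measure.comap Subtype.val volume

theorem volume_closedBall_ne_zero (n : ℕ) :
    volume (closedBall (0 : EuclideanSpace ℝ (Fin n)) 1) ≠ 0 :=
  (measure_closedBall_pos _ _ one_pos).ne'

instance (n : ℕ) : IsProbabilityMeasure (uniformBall n) := by
  constructor
  rw [uniformBall, Measure.smul_apply, comap_subtype_coe_apply measurableSet_closedBall,
    image_univ, Subtype.range_coe, smul_eq_mul]
  exact ENNReal.inv_mul_cancel (volume_closedBall_ne_zero n) measure_closedBall_lt_top.ne

/-- Expected inverse distances between values of the random series are controlled by every single
coordinate. -/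
theorem exists_lintegral_vectorSeries_le [Countable J] {α : ℝ} (hα : 0 < α) (hαn : α < n) :
    ∃ C : ℝ≥0∞, C ≠ ∞ ∧ ∀ (g : J → EuclideanSpace ℝ (Fin n) → ℝ) (b : J → ℝ),
      Summable b → (∀ j x, ‖g j x‖ ≤ b j) → (∀ j, Continuous (g j)) → ∀ x y,
      ∫⁻ ξ, edist (vectorSeries g ξ x) (vectorSeries g ξ y) ^ (-α)
        ∂Measure.infinitePi (fun _ : J => uniformBall n) ≤
        C * ⨅ j, ‖g j x - g j y‖ₑ ^ (-α) := by
  classical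
  obtain ⟨C, hC0, hCt, hC⟩ := lintegral_closedBall_enorm_smul_add_rpow_le n hα hαn
  set V := volume (closedBall (0 : EuclideanSpace ℝ (Fin n)) 1)
  have hV0 : V ≠ 0 := volume_closedBall_ne_zero n
  have hVt : V ≠ ∞ := measure_closedBall_lt_top.ne
  refine ⟨V⁻¹ * C, by finiteness, fun g b hb hgb hg x y => ?_⟩
  rw [ENNReal.mul_iInf_of_ne (mul_ne_zero (by simp [hVt]) hC0) (by finiteness)]
  refine le_iInf fun j => ?_
  have hcont : ∀ x, Continuous fun ξ => vectorSeries g ξ x := fun x =>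
    (continuous_vectorSeries hb hgb hg).comp (continuous_id.prodMk continuous_const)
  have hm : Measurable fun ξ => edist (vectorSeries g ξ x) (vectorSeries g ξ y) ^ (-α) :=
    ((hcont x).measurable.edist (hcont y).measurable).pow_const _
  rw [lintegral_infinitePi_update _ j hm]
  have hin : ∀ ξ : J → closedBall (0 : EuclideanSpace ℝ (Fin n)) 1,
      ∫⁻ t, edist (vectorSeries g (Function.update ξ j t) x)
        (vectorSeries g (Function.update ξ j t) y) ^ (-α) ∂uniformBall n ≤
      V⁻¹ * C * ‖g j x - g j y‖ₑ ^ (-α) := by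
    intro ξ
    set v : EuclideanSpace ℝ (Fin n) := vectorSeries g ξ x - vectorSeries g ξ y -
      (g j x - g j y) • (ξ j : EuclideanSpace ℝ (Fin n)) with hv
    have h1 : ∀ t : closedBall (0 : EuclideanSpace ℝ (Fin n)) 1,
        edist (vectorSeries g (Function.update ξ j t) x)
        (vectorSeries g (Function.update ξ j t) y) ^ (-α) =
        ‖(g j x - g j y) • (t : EuclideanSpace ℝ (Fin n)) + v‖ₑ ^ (-α) := by
      intro t
      rw [vectorSeries_update hb hgb, vectorSeries_update hb hgb, edist_eq_enorm_sub]
      congr 2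
      rw [hv]
      module
    simp_rw [h1]
    rw [uniformBall, lintegral_smul_measure, smul_eq_mul, mul_assoc]
    gcongr
    have := lintegral_subtype_comap (μ := volume)
      (measurableSet_closedBall (x := (0 : EuclideanSpace ℝ (Fin n))) (ε := 1))
      (fun t => ‖(g j x - g j y) • t + v‖ₑ ^ (-α))
    exact this.le.trans (hC _ _)
  calc _ ≤ ∫⁻ _, V⁻¹ * C * ‖g j x - g j y‖ₑ ^ (-α)
        ∂Measure.infinitePi (fun _ : J => uniformBall n) := lintegral_mono hin
    _ = _ := by simp

/-- Almost surely, the random series has finite `α`-energy with respect to `μ` as soon as its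
coefficient functions separate points well enough. -/
theorem ae_lintegral_vectorSeries_ne_top [Countable J] {α : ℝ} (hα : 0 < α) (hαn : α < n)
    {g : J → EuclideanSpace ℝ (Fin n) → ℝ} {b : J → ℝ}
    (hb : Summable b) (hgb : ∀ j x, ‖g j x‖ ≤ b j) (hg : ∀ j, Continuous (g j))
    (μ : Measure (EuclideanSpace ℝ (Fin n))) [IsFiniteMeasure μ]
    (hμ : ∫⁻ x, ∫⁻ y, ⨅ j, ‖g j x - g j y‖ₑ ^ (-α) ∂μ ∂μ ≠ ∞) :
    ∀ᵐ ξ ∂Measure.infinitePi (fun _ : J => uniformBall n),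
      ∫⁻ x, ∫⁻ y, edist (vectorSeries g ξ x) (vectorSeries g ξ y) ^ (-α) ∂μ ∂μ ≠ ∞ := by
  obtain ⟨C, hCt, hC⟩ := exists_lintegral_vectorSeries_le (J := J) hα hαn
  set P := Measure.infinitePi (fun _ : J => uniformBall n)
  have hcont := continuous_vectorSeries hb hgb hg
  have hm : Measurable fun z : ((J → closedBall (0 : EuclideanSpace ℝ (Fin n)) 1) ×
      EuclideanSpace ℝ (Fin n)) × EuclideanSpace ℝ (Fin n) =>
      edist (vectorSeries g z.1.1 z.1.2) (vectorSeries g z.1.1 z.2) ^ (-α) := by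
    refine Measurable.pow_const (Measurable.edist ?_ ?_) _
    · exact (hcont.comp continuous_fst).measurable
    · exact (hcont.comp ((continuous_fst.comp continuous_fst).prodMk continuous_snd)).measurable
  have hm1 := hm.lintegral_prod_right' (ν := μ)
  have hm2 := hm1.lintegral_prod_right' (ν := μ)
  have hfin : ∫⁻ ξ, ∫⁻ x, ∫⁻ y, edist (vectorSeries g ξ x) (vectorSeries g ξ y) ^ (-α) ∂μ ∂μ ∂P
      ≠ ∞ := by
    rw [lintegral_lintegral_swap hm1.aemeasurable]
    refine ne_top_of_le_ne_top (ENNReal.mul_ne_top hCt hμ) ?_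
    rw [← lintegral_const_mul' _ _ hCt]
    refine lintegral_mono fun x => ?_
    rw [lintegral_lintegral_swap]
    · rw [← lintegral_const_mul' _ _ hCt]
      exact lintegral_mono fun y => hC g b hb hgb hg x y
    · exact (hm.comp ((measurable_fst.prodMk measurable_const).prodMk measurable_snd)).aemeasurable
  filter_upwards [ae_lt_top hm2 hfin] with ξ hξ using hξ.ne

end RandomSeries

theorem memW1p_vectorSeries {n : ℕ} {J : Type*} [Countable J] {p : ℝ} (hp : 1 < p)
    {g : J → EuclideanSpace ℝ (Fin n) → ℝ} {b : J → ℝ} (hb : Summable b)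
    (hgb : ∀ j x, ‖g j x‖ ≤ b j) (hgs : ∀ j, ContDiff ℝ 1 (g j))
    (hgd : ∀ j, eLpNorm (fderiv ℝ (g j)) (ENNReal.ofReal p) volume ≤ ENNReal.ofReal (b j))
    (ξ : J → closedBall (0 : EuclideanSpace ℝ (Fin n)) 1) :
    MemW1p n n p univ (vectorSeries g ξ) := by
  have hb0 : ∀ j, 0 ≤ b j := fun j => (norm_nonneg _).trans (hgb j 0)
  have hp1 : (1 : ℝ≥0∞) < ENNReal.ofReal p := by simpa using hp
  have : Fact (1 ≤ ENNReal.ofReal p) := ⟨hp1.le⟩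
  have hconj : ENNReal.HolderConjugate (ENNReal.ofReal p) (ENNReal.ofReal p.conjExponent) :=
    (Real.HolderConjugate.conjExponent hp).ennrealOfReal
  have : ENNReal.HolderConjugate (ENNReal.ofReal p.conjExponent) (ENNReal.ofReal p) :=
    hconj.symm
  have : Fact (1 ≤ ENNReal.ofReal p.conjExponent) :=
    ⟨by simpa using (Real.HolderConjugate.conjExponent hp).symm.lt.le⟩
  let F : J → EuclideanSpace ℝ (Fin n) → EuclideanSpace ℝ (Fin n) :=
    fun j x => g j x • (ξ j : EuclideanSpace ℝ (Fin n))
  let u : J → EuclideanSpace ℝ (Fin n) → EuclideanSpace ℝ (Fin n) →L[ℝ] EuclideanSpace ℝ (Fin n) :=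
    fun j x => (fderiv ℝ (g j) x).smulRight (ξ j : EuclideanSpace ℝ (Fin n))
  have hFs : ∀ j, ContDiff ℝ 1 (F j) := fun j => (hgs j).smul contDiff_const
  have hFu : ∀ j x, fderiv ℝ (F j) x = u j x := fun j x =>
    fderiv_smul_const ((hgs j).differentiable one_ne_zero x) _
  have hcu : ∀ j, Continuous (u j) := fun j => by
    have := (hFs j).continuous_fderiv one_ne_zero
    rwa [show fderiv ℝ (F j) = u j from funext (hFu j)] at this
  have hule : ∀ j, eLpNorm (u j) (ENNReal.ofReal p) volume ≤ ENNReal.ofReal (b j) := by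
    refine fun j => (eLpNorm_mono fun x => ?_).trans (hgd j)
    rw [ContinuousLinearMap.norm_smulRight_apply]
    exact mul_le_of_le_one_right (norm_nonneg _) (norm_coe_closedBall_le _)
  have hmem : ∀ j, MemLp (u j) (ENNReal.ofReal p) volume := fun j =>
    ⟨(hcu j).aestronglyMeasurable, (hule j).trans_lt ENNReal.ofReal_lt_top⟩
  have hsum : Summable fun j => (hmem j).toLp (u j) := by
    refine Summable.of_norm_bounded hb fun j => ?_
    rw [Lp.norm_toLp]
    exact ENNReal.toReal_le_of_le_ofReal (hb0 j) (hule j)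
  set T := ∑' j, (hmem j).toLp (u j) with hT
  refine ⟨T, ?_, ?_, ?_⟩
  · exact ((Lp.memLp T).locallyIntegrable hp1.le).locallyIntegrableOn _
  · have := lintegral_rpow_enorm_lt_top_of_eLpNorm_lt_top (by simp; linarith) (by simp)
      (Lp.memLp T).eLpNorm_lt_top
    rw [ENNReal.toReal_ofReal (by linarith)] at this
    rw [Measure.restrict_univ]
    convert this using 3 with x
    rw [← ofReal_norm, ENNReal.ofReal_rpow_of_nonneg (norm_nonneg _) (by linarith)]
  · intro φ hφ hφc _ v
    rw [Measure.restrict_univ]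
    have hφ' : Continuous fun x => fderiv ℝ φ x v :=
      (hφ.continuous_fderiv (by simp)).clm_apply continuous_const
    have hφ'c : HasCompactSupport fun x => fderiv ℝ φ x v := hφc.fderiv_apply (𝕜 := ℝ) v
    have hint : Integrable (fun x => fderiv ℝ φ x v) volume :=
      hφ'.integrable_of_hasCompactSupport hφ'c
    have hφm : MemLp φ (ENNReal.ofReal p.conjExponent) volume :=
      hφ.continuous.memLp_of_hasCompactSupport hφc
    let B : ℝ →L[ℝ] (EuclideanSpace ℝ (Fin n) →L[ℝ] EuclideanSpace ℝ (Fin n)) →L[ℝ]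
        EuclideanSpace ℝ (Fin n) :=
      ((ContinuousLinearMap.lsmul ℝ ℝ).flip.comp
        (ContinuousLinearMap.apply ℝ (EuclideanSpace ℝ (Fin n)) v)).flip
    have hB : ∀ c S, B c S = c • S v := fun c S => rfl
    let L := B.lpPairing volume (ENNReal.ofReal p.conjExponent) (ENNReal.ofReal p) (hφm.toLp φ)
    have hR : ∫ x, φ x • T x v = ∑' j, ∫ x, φ x • u j x v := by
      have h1 : L T = ∫ x, φ x • T x v := by
        rw [ContinuousLinearMap.lpPairing_eq_integral]
        refine integral_congr_ae ?_
        filter_upwards [hφm.coeFn_toLp] with x hx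
        rw [hB, hx]
      have h2 : ∀ j, L ((hmem j).toLp (u j)) = ∫ x, φ x • u j x v := by
        intro j
        rw [ContinuousLinearMap.lpPairing_eq_integral]
        refine integral_congr_ae ?_
        filter_upwards [hφm.coeFn_toLp, (hmem j).coeFn_toLp] with x hx hx'
        rw [hB, hx, hx']
      rw [← h1, hT, L.map_tsum hsum]
      exact tsum_congr h2
    have hnorm : ∀ j x, ‖fderiv ℝ φ x v • F j x‖ ≤ b j * ‖fderiv ℝ φ x v‖ := by
      intro j x
      rw [norm_smul, mul_comm]
      gcongr
      exact (norm_smul_closedBall_le _ _).trans (hgb j x)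
    have hFint : ∀ j, Integrable (fun x => fderiv ℝ φ x v • F j x) volume := fun j =>
      (hφ'.smul (hFs j).continuous).integrable_of_hasCompactSupport hφ'c.smul_right
    have hLs : HasSum (fun j => ∫ x, fderiv ℝ φ x v • F j x)
        (∫ x, ∑' j, fderiv ℝ φ x v • F j x) := by
      refine hasSum_integral_of_summable_integral_norm hFint ?_
      refine Summable.of_nonneg_of_le (fun j => integral_nonneg fun x => norm_nonneg _)
        (fun j => ?_) (hb.mul_right (∫ x, ‖fderiv ℝ φ x v‖))
      rw [← integral_const_mul]
      exact integral_mono (hFint j).norm (hint.norm.const_mul _) (hnorm j)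
    have hL : ∫ x, fderiv ℝ φ x v • vectorSeries g ξ x =
        ∑' j, ∫ x, fderiv ℝ φ x v • F j x := by
      rw [hLs.tsum_eq]
      refine integral_congr_ae (ae_of_all _ fun x => ?_)
      exact ((summable_vectorSeries hb hgb ξ x).tsum_const_smul _).symm
    rw [hL, hR, ← tsum_neg]
    refine tsum_congr fun j => ?_
    have := integral_smul_fderiv_eq_neg_fderiv_smul_of_integrable (μ := volume) (f := φ)
      (g := F j) (v := v) (hFint j)
      ((hφ.continuous.smul (((hFs j).continuous_fderiv one_ne_zero).clm_apply
        continuous_const)).integrable_of_hasCompactSupport hφc.smul_right)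
      ((hφ.continuous.smul (hFs j).continuous).integrable_of_hasCompactSupport hφc.smul_right)
      (fun x _ => hφ.differentiable (by simp) x)
      (fun x _ => (hFs j).differentiable one_ne_zero x)
    rw [← neg_eq_iff_eq_neg] at this
    rw [← this]
    simp only [hFu]

section Lattice

variable {n : ℕ}

/-- An integer vector as a point of Euclidean space. -/
def latticePoint (k : Fin n → ℤ) : EuclideanSpace ℝ (Fin n) :=
  WithLp.toLp 2 fun i => (k i : ℝ)

/-- The coordinatewise floor. -/
def latticeFloor (v : EuclideanSpace ℝ (Fin n)) : Fin n → ℤ :=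
  fun i => ⌊v i⌋

theorem norm_le_of_abs_apply_le {v : EuclideanSpace ℝ (Fin n)} {c : ℝ} (hc : 0 ≤ c)
    (hv : ∀ i, |v i| ≤ c) : ‖v‖ ≤ n * c := by
  rw [EuclideanSpace.norm_eq]
  refine Real.sqrt_le_iff.2 ⟨by positivity, ?_⟩
  have hle : ∀ i, ‖v i‖ ^ 2 ≤ c ^ 2 := fun i => by
    gcongr
    exact hv i
  refine (Finset.sum_le_sum fun i _ => hle i).trans ?_
  rw [Finset.sum_const, Finset.card_univ, Fintype.card_fin, nsmul_eq_mul, mul_pow]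
  gcongr
  exact_mod_cast Nat.le_self_pow two_ne_zero n

theorem norm_sub_latticePoint_latticeFloor_le (v : EuclideanSpace ℝ (Fin n)) :
    ‖v - latticePoint (latticeFloor v)‖ ≤ n := by
  rw [← mul_one (n : ℝ)]
  refine norm_le_of_abs_apply_le zero_le_one fun i => ?_
  change |v i - (⌊v i⌋ : ℝ)| ≤ 1
  rw [abs_of_nonneg (sub_nonneg.2 (Int.floor_le _))]
  linarith [Int.lt_floor_add_one (v i)]

theorem le_norm_latticePoint_sub {M : ℕ} {k l : Fin n → ℤ} (hkl : k ≠ l)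
    (h : ∀ i, (k i : ZMod M) = l i) : (M : ℝ) ≤ ‖latticePoint k - latticePoint l‖ := by
  obtain ⟨i, hi⟩ := Function.ne_iff.1 hkl
  refine le_trans ?_ (PiLp.norm_apply_le (latticePoint k - latticePoint l) i)
  change (M : ℝ) ≤ |(k i : ℝ) - l i|
  have hd : (M : ℤ) ∣ k i - l i := by
    rw [← ZMod.intCast_eq_intCast_iff_dvd_sub]
    exact (h i).symm
  have := Int.le_of_dvd (abs_pos.2 (sub_ne_zero.2 hi)) ((dvd_abs _ _).2 hd)
  exact_mod_cast this

theorem finite_image_latticeFloor_smul {K : Set (EuclideanSpace ℝ (Fin n))}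
    (hK : Bornology.IsBounded K) {r : ℝ} (hr : 0 ≤ r) :
    ((fun x => latticeFloor (r • x)) '' K).Finite := by
  obtain ⟨R, hR⟩ := hK.exists_norm_le
  refine (Fintype.piFinset fun _ : Fin n =>
    Finset.Icc ⌊-(r * R)⌋ ⌊r * R⌋).finite_toSet.subset ?_
  rintro _ ⟨x, hxK, rfl⟩
  simp only [Fintype.coe_piFinset, Finset.coe_Icc, Set.mem_pi, mem_univ, true_implies]
  intro i
  have hx : |x i| ≤ R := (PiLp.norm_apply_le x i).trans (hR x hxK)
  rw [abs_le] at hx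
  have h1 : -(r * R) ≤ r * x i := by nlinarith
  have h2 : r * x i ≤ r * R := by nlinarith
  exact ⟨Int.floor_le_floor h1, Int.floor_le_floor h2⟩

end Lattice

section Frostman

/-- A set of positive Hausdorff measure in a compact space supports a content. -/
theorem exists_outerMeasure_le_ediam_rpow {X : Type*} [MetricSpace X] [CompactSpace X]
    [MeasurableSpace X] [BorelSpace X] {s : ℝ} (hs : 0 < s) (hX : μH[s] (univ : Set X) ≠ 0) :
    ∃ h : OuterMeasure X, h univ ≠ 0 ∧ h univ ≠ ∞ ∧
      ∃ C : ℝ≥0∞, C ≠ ∞ ∧ ∀ A : Set X, h A ≤ C * ediam A ^ s := by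
  have h0 : OuterMeasure.mkMetric' (fun A : Set X => ediam A ^ s) univ ≠ 0 := by
    have := OuterMeasure.coe_mkMetric (X := X) fun r => r ^ s
    rw [OuterMeasure.mkMetric] at this
    rw [this]
    exact hX
  rw [OuterMeasure.mkMetric'.eq_iSup_nat, OuterMeasure.iSup_apply] at h0
  obtain ⟨k, hk⟩ : ∃ k : ℕ, OuterMeasure.mkMetric'.pre (fun A : Set X => ediam A ^ s)
      (k : ℝ≥0∞)⁻¹ univ ≠ 0 := by
    by_contra! hcon
    exact h0 (by simp [hcon])
  set δ : ℝ≥0∞ := ((k + 1 : ℕ) : ℝ≥0∞)⁻¹ with hδ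
  have hδ0 : δ ≠ 0 := by simp [hδ]
  have hδt : δ ≠ ∞ := by
    rw [hδ, Ne, ENNReal.inv_eq_top]
    exact_mod_cast k.succ_ne_zero
  set h := OuterMeasure.mkMetric'.pre (fun A : Set X => ediam A ^ s) δ
  have hle : ∀ A : Set X, ediam A ≤ δ → h A ≤ ediam A ^ s := fun A hA =>
    OuterMeasure.mkMetric'.pre_le hA
  have hpos : h univ ≠ 0 := by
    refine (lt_of_lt_of_le (pos_iff_ne_zero.2 hk) ?_).ne'
    exact OuterMeasure.mkMetric'.mono_pre_nat _ k.le_succ univ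
  have hfin : h univ ≠ ∞ := by
    have hδ2 : 0 < δ.toReal / 2 := half_pos (ENNReal.toReal_pos hδ0 hδt)
    obtain ⟨t, -, htf, ht⟩ := (isCompact_univ (X := X)).finite_cover_balls hδ2
    refine ne_top_of_le_ne_top ?_ ((measure_mono ht).trans
      (measure_biUnion_le h htf.countable _))
    have : Fintype t := htf.fintype
    rw [tsum_fintype]
    refine (ENNReal.sum_lt_top.2 fun i _ => ?_).ne
    have hd : ediam (ball (i : X) (δ.toReal / 2)) ≤ δ := by
      rw [← Metric.eball_ofReal]
      refine ediam_eball_le.trans ?_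
      rw [ENNReal.ofReal_div_of_pos two_pos, ENNReal.ofReal_toReal hδt, ENNReal.ofReal_ofNat,
        ENNReal.mul_div_cancel two_ne_zero ENNReal.ofNat_ne_top]
    exact (hle _ hd).trans_lt
      (ENNReal.rpow_lt_top_of_nonneg hs.le (ne_top_of_le_ne_top hδt hd))
  have hδs0 : δ ^ s ≠ 0 := by
    rw [Ne, ENNReal.rpow_eq_zero_iff]
    rintro (⟨h, -⟩ | ⟨h, -⟩)
    exacts [hδ0 h, hδt h]
  have hδst : δ ^ s ≠ ∞ := (ENNReal.rpow_lt_top_of_nonneg hs.le hδt).ne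
  refine ⟨h, hpos, hfin, 1 + h univ / δ ^ s,
    ENNReal.add_ne_top.2 ⟨ENNReal.one_ne_top, ENNReal.div_ne_top hfin hδs0⟩, fun A => ?_⟩
  rw [add_mul, one_mul]
  rcases le_total (ediam A) δ with hA | hA
  · exact (hle A hA).trans le_self_add
  · calc h A ≤ h univ := measure_mono (subset_univ _)
      _ = h univ / δ ^ s * δ ^ s := (ENNReal.div_mul_cancel hδs0 hδst).symm
      _ ≤ h univ / δ ^ s * ediam A ^ s := by gcongr
      _ ≤ _ := le_add_self

/-- Mass distribution along `k` generations of a tree of nested cells. -/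
theorem exists_measure_le_outerMeasure_cells {X I : Type*} [MeasurableSpace X]
    [MeasurableSingletonClass X] (h : OuterMeasure X) (hfin : h univ ≠ ∞) (c : ℕ → X → I)
    (hc : ∀ l, (range (c l)).Finite)
    (hnest : ∀ j l, j ≤ l → ∀ x y, c l x = c l y → c j x = c j y) (k : ℕ) :
    ∀ j i, ∃ ν : Measure X, ν univ = h (c j ⁻¹' {i}) ∧ ν (c j ⁻¹' {i})ᶜ = 0 ∧
      ∀ l, j ≤ l → l ≤ j + k → ∀ i', ν (c l ⁻¹' {i'}) ≤ h (c l ⁻¹' {i'}) := by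
  have hft : ∀ A : Set X, h A ≠ ∞ := fun A => ne_top_of_le_ne_top hfin (measure_mono (subset_univ A))
  have htop : ∀ (ν : Measure X) j i, ν univ = h (c j ⁻¹' {i}) → ν (c j ⁻¹' {i})ᶜ = 0 →
      ∀ i', ν (c j ⁻¹' {i'}) ≤ h (c j ⁻¹' {i'}) := by
    intro ν j i h1 h2 i'
    rcases eq_or_ne i' i with rfl | hi
    · exact (measure_mono (subset_univ _)).trans h1.le
    · rw [measure_mono_null ?_ h2]
      · exact zero_le
      · rintro x rfl hx
        exact hi hx
  induction k with
  | zero =>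
    intro j i
    obtain ⟨ν, h1, h2⟩ : ∃ ν : Measure X, ν univ = h (c j ⁻¹' {i}) ∧ ν (c j ⁻¹' {i})ᶜ = 0 := by
      rcases (c j ⁻¹' {i}).eq_empty_or_nonempty with he | ⟨x, hx⟩
      · exact ⟨0, by simp [he], by simp⟩
      · refine ⟨h (c j ⁻¹' {i}) • Measure.dirac x, by simp, ?_⟩
        rw [Measure.smul_apply, Measure.dirac_apply, indicator_of_notMem (by simpa using hx),
          smul_zero]
    refine ⟨ν, h1, h2, fun l hl hl' => ?_⟩
    obtain rfl : l = j := by lia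
    exact htop ν l i h1 h2
  | succ k ih =>
    intro j i
    choose ν h1 h2 h3 using fun i' => ih (j + 1) i'
    have hSf : (c (j + 1) '' (c j ⁻¹' {i})).Finite := (hc (j + 1)).subset (image_subset_range _ _)
    set S := hSf.toFinset with hS
    set H := ∑ i' ∈ S, h (c (j + 1) ⁻¹' {i'}) with hH
    have hHt : H ≠ ∞ := (ENNReal.sum_lt_top.2 fun i' _ => (hft _).lt_top).ne
    have hleH : h (c j ⁻¹' {i}) ≤ H := by
      refine (measure_mono ?_).trans (measure_biUnion_finset_le S _)
      intro x hx
      simp only [mem_iUnion]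
      exact ⟨c (j + 1) x, by simpa [hS] using ⟨x, hx, rfl⟩, rfl⟩
    have hsub : ∀ i' ∈ S, c (j + 1) ⁻¹' {i'} ⊆ c j ⁻¹' {i} := by
      intro i' hi' x hx
      simp only [hS, Finite.mem_toFinset] at hi'
      obtain ⟨y, hy, rfl⟩ := hi'
      exact (hnest j (j + 1) j.le_succ x y hx).trans hy
    set r := h (c j ⁻¹' {i}) / H with hr
    have hr1 : r ≤ 1 := ENNReal.div_le_of_le_mul (by simpa using hleH)
    have hu : (r • ∑ i' ∈ S, ν i') univ = h (c j ⁻¹' {i}) := by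
      rw [Measure.smul_apply, Measure.finsetSum_apply, Finset.sum_congr rfl fun i' _ => h1 i',
        ← hH, smul_eq_mul]
      rcases eq_or_ne H 0 with h0 | h0
      · rw [h0] at hleH
        rw [h0, mul_zero, nonpos_iff_eq_zero.1 hleH]
      · exact ENNReal.div_mul_cancel h0 hHt
    have hz : (r • ∑ i' ∈ S, ν i') (c j ⁻¹' {i})ᶜ = 0 := by
      rw [Measure.smul_apply, Measure.finsetSum_apply, Finset.sum_eq_zero, smul_zero]
      intro i' hi'
      exact measure_mono_null (compl_subset_compl.2 (hsub i' hi')) (h2 i')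
    refine ⟨r • ∑ i' ∈ S, ν i', hu, hz, fun l hl hl' i'' => ?_⟩
    rcases hl.eq_or_lt with rfl | hlt
    · exact htop _ j i hu hz i''
    rcases (c l ⁻¹' {i''}).eq_empty_or_nonempty with he | ⟨x, rfl⟩
    · simp [he]
    rw [Measure.smul_apply, Measure.finsetSum_apply, smul_eq_mul]
    have hne : ∀ i' ∈ S, i' ≠ c (j + 1) x → ν i' (c l ⁻¹' {c l x}) = 0 := by
      intro i' _ hi'
      refine measure_mono_null (t := (c (j + 1) ⁻¹' {i'})ᶜ) (fun y hy hy' => hi' ?_) (h2 i')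
      rw [← hnest (j + 1) l hlt y x hy]
      exact hy'.symm
    calc r * ∑ i' ∈ S, ν i' (c l ⁻¹' {c l x})
        ≤ 1 * ν (c (j + 1) x) (c l ⁻¹' {c l x}) := by
          gcongr
          by_cases hx : c (j + 1) x ∈ S
          · rw [Finset.sum_eq_single_of_mem _ hx hne]
          · rw [Finset.sum_eq_zero fun i' hi' => hne i' hi' (by rintro rfl; exact hx hi')]
            exact zero_le
      _ ≤ _ := by
          rw [one_mul]
          exact h3 _ l hlt (by lia) _

/-- A Frostman measure on a compact space with a tree of nested cells of geometrically decreasing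
diameter, such that a ball meets a bounded number of cells of the same size. -/
theorem exists_probabilityMeasure_ball_le {X I : Type*} [MetricSpace X] [CompactSpace X]
    [MeasurableSpace X] [BorelSpace X] {s : ℝ} (hs : 0 < s) (hX : μH[s] (univ : Set X) ≠ 0)
    (c : ℕ → X → I) (hc : ∀ l, (range (c l)).Finite)
    (hnest : ∀ j l, j ≤ l → ∀ x y, c l x = c l y → c j x = c j y) (D : ℝ)
    (hD : ∀ l i, ediam (c l ⁻¹' {i}) ≤ ENNReal.ofReal (D * (1 / 2) ^ l)) (N : ℕ)
    (hN : ∀ l x, ∃ T : Finset I, T.card ≤ N ∧ ball x (2 * (1 / 2) ^ l) ⊆ ⋃ i ∈ T, c l ⁻¹' {i}) :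
    ∃ μ : Measure X, IsProbabilityMeasure μ ∧ ∃ A : ℝ≥0∞, A ≠ ∞ ∧
      ∀ (l : ℕ) (x : X), μ (ball x (2 * (1 / 2) ^ l)) ≤ A * ENNReal.ofReal ((1 / 2) ^ l) ^ s := by
  obtain ⟨h, h0, hfin, C, hC, hle⟩ := exists_outerMeasure_le_ediam_rpow hs hX
  have hft : ∀ A : Set X, h A ≠ ∞ := fun A => ne_top_of_le_ne_top hfin (measure_mono (subset_univ A))
  obtain ⟨i, hi⟩ : ∃ i, h (c 0 ⁻¹' {i}) ≠ 0 := by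
    by_contra! hcon
    refine h0 (measure_mono_null (t := ⋃ i ∈ range (c 0), c 0 ⁻¹' {i}) (fun x _ => ?_)
      ((measure_biUnion_null_iff (hc 0).countable).2 fun i _ => hcon i))
    simp only [mem_iUnion]
    exact ⟨c 0 x, mem_range_self x, rfl⟩
  set m := h (c 0 ⁻¹' {i}) with hm
  have hmt : m ≠ ∞ := hft _
  choose ν h1 _ h3 using fun k => exists_measure_le_outerMeasure_cells h hfin c hc hnest k 0 i
  have hprob : ∀ k, IsProbabilityMeasure (m⁻¹ • ν k) := fun k => ⟨by
    rw [Measure.smul_apply, h1, smul_eq_mul, ENNReal.inv_mul_cancel hi hmt]⟩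
  let P : ℕ → ProbabilityMeasure X := fun k => ⟨m⁻¹ • ν k, hprob k⟩
  obtain ⟨μ, φ, hφ, hlim⟩ := CompactSpace.tendsto_subseq P
  refine ⟨μ, inferInstance, m⁻¹ * (N * (C * ENNReal.ofReal D ^ s)), ?_, fun l x => ?_⟩
  · refine ENNReal.mul_ne_top (ENNReal.inv_ne_top.2 hi) (ENNReal.mul_ne_top (by simp)
      (ENNReal.mul_ne_top hC (ENNReal.rpow_lt_top_of_nonneg hs.le ENNReal.ofReal_ne_top).ne))
  · refine (ProbabilityMeasure.le_liminf_measure_open_of_tendsto hlim isOpen_ball).trans ?_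
    refine Filter.liminf_le_of_frequently_le' (Eventually.frequently ?_)
    filter_upwards [eventually_ge_atTop l] with k hk
    have hlk : l ≤ 0 + φ k := by simpa using hk.trans (hφ.id_le k)
    obtain ⟨T, hT, hsub⟩ := hN l x
    change (m⁻¹ • ν (φ k)) _ ≤ _
    rw [Measure.smul_apply, smul_eq_mul, mul_assoc]
    gcongr
    calc ν (φ k) (ball x (2 * (1 / 2) ^ l))
        ≤ ∑ i' ∈ T, ν (φ k) (c l ⁻¹' {i'}) :=
          (measure_mono hsub).trans (measure_biUnion_finset_le _ _)
      _ ≤ ∑ i' ∈ T, C * (ENNReal.ofReal D ^ s * ENNReal.ofReal ((1 / 2) ^ l) ^ s) := by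
          refine Finset.sum_le_sum fun i' _ => ?_
          refine (h3 (φ k) l l.zero_le hlk i').trans ((hle _).trans ?_)
          gcongr
          rw [← ENNReal.mul_rpow_of_nonneg _ _ hs.le, ← ENNReal.ofReal_mul' (by positivity)]
          exact ENNReal.rpow_le_rpow (hD l i') hs.le
      _ ≤ N * (C * (ENNReal.ofReal D ^ s * ENNReal.ofReal ((1 / 2) ^ l) ^ s)) := by
          rw [Finset.sum_const, nsmul_eq_mul]
          gcongr
      _ = _ := by ring

/-- Frostman's lemma for compact subsets of Euclidean space. -/
theorem exists_measure_closedBall_le_rpow {n : ℕ} {K : Set (EuclideanSpace ℝ (Fin n))}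
    (hK : IsCompact K) {s : ℝ} (hs : 0 < s) (hμ : μH[s] K ≠ 0) :
    ∃ μ : Measure (EuclideanSpace ℝ (Fin n)), IsProbabilityMeasure μ ∧ μ Kᶜ = 0 ∧
      ∃ A : ℝ≥0∞, A ≠ ∞ ∧ ∀ x ∈ K, ∀ r : ℝ, 0 < r →
        μ (closedBall x r) ≤ A * ENNReal.ofReal r ^ s := by
  have : CompactSpace K := isCompact_iff_compactSpace.1 hK
  have hX : μH[s] (univ : Set K) ≠ 0 := by
    rw [← isometry_subtype_coe.hausdorffMeasure_image (Or.inl hs.le), image_univ,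
      Subtype.range_coe]
    exact hμ
  let c : ℕ → K → Fin n → ℤ := fun l x =>
    latticeFloor ((2 : ℝ) ^ l • (x : EuclideanSpace ℝ (Fin n)))
  have hcl : ∀ l x i, c l x i = ⌊2 ^ l * (x : EuclideanSpace ℝ (Fin n)) i⌋ := fun _ _ _ => rfl
  have hpow : ∀ l : ℕ, (2 : ℝ) ^ l * (1 / 2) ^ l = 1 := fun l => by
    rw [← mul_pow]; norm_num
  have hc : ∀ l, (range (c l)).Finite := fun l =>
    (finite_image_latticeFloor_smul hK.isBounded (by positivity : (0 : ℝ) ≤ 2 ^ l)).subset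
      (range_subset_iff.2 fun x => mem_image_of_mem _ x.2)
  have hnest : ∀ j l, j ≤ l → ∀ x y, c l x = c l y → c j x = c j y := by
    intro j l hjl x y hxy
    induction l, hjl using Nat.le_induction with
    | base => exact hxy
    | succ l _ ih =>
      refine ih (funext fun i => ?_)
      have := congrFun hxy i
      have key : ∀ t : ℝ, ⌊2 ^ l * t⌋ = ⌊2 ^ (l + 1) * t⌋ / (2 : ℕ) := by
        intro t
        rw [← Int.floor_div_natCast]
        congr 1
        rw [pow_succ]; push_cast; ring
      rw [hcl, hcl] at this ⊢
      rw [key, key, this]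
  have hcoord : ∀ (l : ℕ) (x y : K), (∀ i, |2 ^ l * (x : EuclideanSpace ℝ (Fin n)) i -
      2 ^ l * (y : EuclideanSpace ℝ (Fin n)) i| ≤ 1) → dist x y ≤ n * (1 / 2) ^ l := by
    intro l x y hxy
    rw [Subtype.dist_eq, dist_eq_norm]
    refine norm_le_of_abs_apply_le (by positivity) fun i => ?_
    have h3 := hxy i
    rw [← mul_sub, abs_mul, abs_of_pos (by positivity : (0 : ℝ) < 2 ^ l), ← hpow l] at h3
    exact le_of_mul_le_mul_left h3 (by positivity)
  have hD : ∀ l i, ediam (c l ⁻¹' {i}) ≤ ENNReal.ofReal (n * (1 / 2) ^ l) := by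
    intro l i
    refine ediam_le fun x hx y hy => ?_
    rw [edist_dist]
    refine ENNReal.ofReal_le_ofReal (hcoord l x y fun i' => ?_)
    have : c l x i' = c l y i' := by rw [show c l x = i from hx, show c l y = i from hy]
    exact (Int.abs_sub_lt_one_of_floor_eq_floor this).le
  have hN : ∀ l x, ∃ T : Finset (Fin n → ℤ), T.card ≤ 5 ^ n ∧
      ball x (2 * (1 / 2) ^ l) ⊆ ⋃ i ∈ T, c l ⁻¹' {i} := by
    intro l x
    refine ⟨Fintype.piFinset fun i => Finset.Icc (c l x i - 2) (c l x i + 2), ?_, fun y hy => ?_⟩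
    · rw [Fintype.card_piFinset]
      refine (Finset.prod_le_pow_card _ _ 5 fun i _ => ?_).trans (by simp)
      rw [Int.card_Icc]
      lia
    · simp only [mem_iUnion]
      refine ⟨c l y, ?_, rfl⟩
      rw [Fintype.mem_piFinset]
      intro i
      have h1 : |(y : EuclideanSpace ℝ (Fin n)) i - (x : EuclideanSpace ℝ (Fin n)) i|
          < 2 * (1 / 2) ^ l := by
        refine lt_of_le_of_lt ?_ (mem_ball.1 hy)
        rw [Subtype.dist_eq, dist_eq_norm]
        exact PiLp.norm_apply_le ((y : EuclideanSpace ℝ (Fin n)) - (x : EuclideanSpace ℝ (Fin n))) i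
      have h2 : |2 ^ l * (y : EuclideanSpace ℝ (Fin n)) i -
          2 ^ l * (x : EuclideanSpace ℝ (Fin n)) i| < 2 := by
        rw [← mul_sub, abs_mul, abs_of_pos (by positivity : (0 : ℝ) < 2 ^ l)]
        calc _ < (2 : ℝ) ^ l * (2 * (1 / 2) ^ l) := by gcongr
          _ = 2 * (2 ^ l * (1 / 2) ^ l) := by ring
          _ = 2 := by rw [hpow, mul_one]
      rw [abs_lt] at h2
      rw [Finset.mem_Icc, hcl, hcl]
      constructor
      · rw [sub_le_iff_le_add, ← Int.floor_add_ofNat]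
        exact Int.floor_le_floor (by linarith)
      · rw [← Int.floor_add_ofNat]
        exact Int.floor_le_floor (by linarith)
  obtain ⟨ν, hν, A, hA, hball⟩ := exists_probabilityMeasure_ball_le hs hX c hc hnest n hD (5 ^ n) hN
  have hme : MeasurableEmbedding (Subtype.val : K → EuclideanSpace ℝ (Fin n)) :=
    MeasurableEmbedding.subtype_coe hK.measurableSet
  refine ⟨ν.map Subtype.val, Measure.isProbabilityMeasure_map hme.measurable.aemeasurable, ?_,
    1 + A * 2 ^ s, ENNReal.add_ne_top.2 ⟨ENNReal.one_ne_top, ENNReal.mul_ne_top hA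
      (ENNReal.rpow_lt_top_of_nonneg hs.le ENNReal.ofNat_ne_top).ne⟩, fun x hx r hr => ?_⟩
  · rw [hme.map_apply]
    simp
  rw [hme.map_apply, add_mul, one_mul]
  rcases le_total 1 r with h1 | h1
  · refine prob_le_one.trans (le_trans ?_ le_self_add)
    exact ENNReal.one_le_rpow (by simpa using h1) hs
  · obtain ⟨l, hl1, hl2⟩ := exists_nat_pow_near_of_lt_one hr h1 (by norm_num : (0 : ℝ) < 1 / 2)
      (by norm_num)
    refine le_trans ?_ le_add_self
    refine (measure_mono fun y hy => ?_).trans ((hball l ⟨x, hx⟩).trans ?_)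
    · have : dist (y : EuclideanSpace ℝ (Fin n)) x ≤ r := hy
      have h2 : (0 : ℝ) < (1 / 2) ^ l := by positivity
      rw [mem_ball, Subtype.dist_eq]
      linarith
    · rw [mul_assoc, ← ENNReal.mul_rpow_of_nonneg _ _ hs.le]
      gcongr
      rw [← ENNReal.ofReal_ofNat 2, ← ENNReal.ofReal_mul two_pos.le]
      refine ENNReal.ofReal_le_ofReal ?_
      rw [pow_succ] at hl1
      linarith

end Frostman

theorem lt_norm_sub_of_norm_sub_le {E ι : Type*} [NormedAddCommGroup E] {S : Finset ι}
    {κ : ι → E} {R : ℝ}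
    (hκ : ∀ i ∈ S, ∀ j ∈ S, i ≠ j → 2 * R < ‖κ i - κ j‖)
    {v : E} {i j : ι} (hi : i ∈ S) (hj : j ∈ S) (hij : j ≠ i) (hv : ‖v - κ i‖ ≤ R) :
    R < ‖v - κ j‖ := by
  have h1 := hκ i hi j hj hij.symm
  have h2 : ‖κ i - κ j‖ ≤ ‖v - κ i‖ + ‖v - κ j‖ := by
    rw [norm_sub_rev v (κ i)]
    simpa using norm_add_le (κ i - v) (v - κ j)
  linarith

section BumpSum

variable {E ι : Type*} [NormedAddCommGroup E] [NormedSpace ℝ E]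

/-- A sum of rescaled translates of `ψ` with weights `a`. -/
def bumpSum (ψ : E → ℝ) (S : Finset ι) (κ : ι → E) (a : ι → ℝ) (r : ℝ) (x : E) : ℝ :=
  ∑ i ∈ S, a i * ψ (r • x - κ i)

variable {ψ : E → ℝ} {S : Finset ι} {κ : ι → E} {a : ι → ℝ} {r R : ℝ}

theorem contDiff_bumpSum (hψ : ContDiff ℝ 1 ψ) : ContDiff ℝ 1 (bumpSum ψ S κ a r) :=
  ContDiff.sum fun _ _ =>
    contDiff_const.mul (hψ.comp ((contDiff_const_smul r).sub contDiff_const))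

theorem bumpSum_eq_zero (hψR : ∀ v, R ≤ ‖v‖ → ψ v = 0) {x : E}
    (hx : ∀ i ∈ S, R ≤ ‖r • x - κ i‖) : bumpSum ψ S κ a r x = 0 :=
  Finset.sum_eq_zero fun i hi => by rw [hψR _ (hx i hi), mul_zero]

theorem bumpSum_eq_of_norm_sub_le (hψR : ∀ v, R ≤ ‖v‖ → ψ v = 0)
    (hκ : ∀ i ∈ S, ∀ j ∈ S, i ≠ j → 2 * R < ‖κ i - κ j‖) {x : E} {i : ι} (hi : i ∈ S)
    (hx : ‖r • x - κ i‖ ≤ R) : bumpSum ψ S κ a r x = a i * ψ (r • x - κ i) :=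
  Finset.sum_eq_single_of_mem i hi fun j hj hij => by
    rw [hψR _ (lt_norm_sub_of_norm_sub_le hκ hi hj hij hx).le, mul_zero]

theorem norm_bumpSum_le (hψR : ∀ v, R ≤ ‖v‖ → ψ v = 0) (hψ1 : ∀ v, ‖ψ v‖ ≤ 1)
    (hκ : ∀ i ∈ S, ∀ j ∈ S, i ≠ j → 2 * R < ‖κ i - κ j‖) {M : ℝ} (hM : 0 ≤ M)
    (ha : ∀ i ∈ S, ‖a i‖ ≤ M) (x : E) : ‖bumpSum ψ S κ a r x‖ ≤ M := by
  by_cases hx : ∃ i ∈ S, ‖r • x - κ i‖ ≤ R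
  · obtain ⟨i, hi, hx⟩ := hx
    rw [bumpSum_eq_of_norm_sub_le hψR hκ hi hx, norm_mul]
    exact (mul_le_mul (ha i hi) (hψ1 _) (norm_nonneg _) hM).trans (mul_one M).le
  · push Not at hx
    rw [bumpSum_eq_zero hψR fun i hi => (hx i hi).le, norm_zero]
    exact hM

theorem fderiv_bumpSum (hψ : ContDiff ℝ 1 ψ) (x : E) :
    fderiv ℝ (bumpSum ψ S κ a r) x = ∑ i ∈ S, (a i * r) • fderiv ℝ ψ (r • x - κ i) := by
  refine HasFDerivAt.fderiv (HasFDerivAt.fun_sum fun i _ => ?_)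
  have h1 : HasFDerivAt (fun x : E => r • x - κ i) (r • ContinuousLinearMap.id ℝ E) x :=
    ((hasFDerivAt_id x).const_smul r).sub_const _
  have h2 := ((hψ.differentiable one_ne_zero (r • x - κ i)).hasFDerivAt.comp x h1).const_mul (a i)
  rw [ContinuousLinearMap.comp_smul, ContinuousLinearMap.comp_id, smul_smul] at h2
  exact h2

theorem enorm_fderiv_bumpSum_rpow_le (hψ : ContDiff ℝ 1 ψ) (hψR : ∀ v, R ≤ ‖v‖ → ψ v = 0)
    (hκ : ∀ i ∈ S, ∀ j ∈ S, i ≠ j → 2 * R < ‖κ i - κ j‖) {p : ℝ} (hp : 0 < p) (x : E) :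
    ‖fderiv ℝ (bumpSum ψ S κ a r) x‖ₑ ^ p ≤
      ∑ i ∈ S, ‖a i * r‖ₑ ^ p * ‖fderiv ℝ ψ (r • x - κ i)‖ₑ ^ p := by
  have hd : ∀ v, R < ‖v‖ → fderiv ℝ ψ v = 0 := by
    intro v hv
    have : ψ =ᶠ[𝓝 v] fun _ => 0 := by
      filter_upwards [(isOpen_lt continuous_const continuous_norm).mem_nhds hv] with w hw
      exact hψR w (le_of_lt hw)
    rw [this.fderiv_eq, fderiv_fun_const, Pi.zero_apply]
  rw [fderiv_bumpSum hψ]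
  by_cases hx : ∃ i ∈ S, ‖r • x - κ i‖ ≤ R
  · obtain ⟨i, hi, hx⟩ := hx
    rw [Finset.sum_eq_single_of_mem i hi fun j hj hij => by
      rw [hd _ (lt_norm_sub_of_norm_sub_le hκ hi hj hij hx), smul_zero], enorm_smul,
      ENNReal.mul_rpow_of_nonneg _ _ hp.le]
    exact Finset.single_le_sum (f := fun i => ‖a i * r‖ₑ ^ p * ‖fderiv ℝ ψ (r • x - κ i)‖ₑ ^ p)
      (fun _ _ => zero_le) hi
  · push Not at hx
    have h0 : ∑ i ∈ S, (a i * r) • fderiv ℝ ψ (r • x - κ i) = 0 :=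
      Finset.sum_eq_zero fun i hi => by rw [hd _ (hx i hi), smul_zero]
    rw [h0, enorm_eq_nnnorm, nnnorm_zero, ENNReal.coe_zero, ENNReal.zero_rpow_of_pos hp]
    exact zero_le

theorem lintegral_comp_smul_sub [FiniteDimensional ℝ E] [MeasurableSpace E] [BorelSpace E]
    (μ : Measure E) [μ.IsAddHaarMeasure] (hr : 0 < r) (c : E) {f : E → ℝ≥0∞} (hf : Measurable f) :
    ∫⁻ x, f (r • x - c) ∂μ = ENNReal.ofReal ((r ^ Module.finrank ℝ E)⁻¹) * ∫⁻ x, f x ∂μ := by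
  rw [← lintegral_sub_right_eq_self f c, ← lintegral_map (f := fun y => f (y - c))
    (hf.comp (measurable_sub_const c)) (measurable_const_smul r),
    Measure.map_addHaar_smul μ hr.ne', lintegral_smul_measure, abs_of_pos (by positivity),
    smul_eq_mul]

theorem lintegral_enorm_fderiv_bumpSum_rpow_le [FiniteDimensional ℝ E] [MeasurableSpace E]
    [BorelSpace E] (μ : Measure E) [μ.IsAddHaarMeasure] (hψ : ContDiff ℝ 1 ψ)
    (hψR : ∀ v, R ≤ ‖v‖ → ψ v = 0)
    (hκ : ∀ i ∈ S, ∀ j ∈ S, i ≠ j → 2 * R < ‖κ i - κ j‖) {p : ℝ} (hp : 0 < p) (hr : 0 < r) :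
    ∫⁻ x, ‖fderiv ℝ (bumpSum ψ S κ a r) x‖ₑ ^ p ∂μ ≤
      (∑ i ∈ S, ‖a i * r‖ₑ ^ p) * (ENNReal.ofReal ((r ^ Module.finrank ℝ E)⁻¹) *
        ∫⁻ x, ‖fderiv ℝ ψ x‖ₑ ^ p ∂μ) := by
  have hm : Measurable fun v => ‖fderiv ℝ ψ v‖ₑ ^ p :=
    (hψ.continuous_fderiv one_ne_zero).enorm.measurable.pow_const p
  have hm' : ∀ i, Measurable fun x => ‖fderiv ℝ ψ (r • x - κ i)‖ₑ ^ p := fun i =>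
    hm.comp ((measurable_const_smul r).sub_const _)
  refine (lintegral_mono fun x => enorm_fderiv_bumpSum_rpow_le hψ hψR hκ hp x).trans ?_
  rw [lintegral_finsetSum _ fun i _ => (hm' i).const_mul _, Finset.sum_mul]
  refine Finset.sum_le_sum fun i _ => ?_
  rw [lintegral_const_mul _ (hm' i), lintegral_comp_smul_sub μ hr _ hm]

end BumpSum

theorem eLpNorm_fderiv_bumpSum_le {E ι : Type*} [NormedAddCommGroup E] [NormedSpace ℝ E]
    [FiniteDimensional ℝ E] [MeasurableSpace E] [BorelSpace E] (μ ν : Measure E)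
    [μ.IsAddHaarMeasure] [IsProbabilityMeasure ν] {ψ : E → ℝ} (hψ : ContDiff ℝ 1 ψ) {R ρ : ℝ}
    (hRρ : R ≤ ρ) (hψR : ∀ v, R ≤ ‖v‖ → ψ v = 0) {S : Finset ι} {κ : ι → E}
    (hκ : ∀ i ∈ S, ∀ j ∈ S, i ≠ j → 2 * ρ < ‖κ i - κ j‖) {p : ℝ} (hp : 0 < p) {r : ℝ} (hr : 0 < r)
    (τ : ℝ) :
    eLpNorm (fderiv ℝ (bumpSum ψ S κ
        (fun i => r ^ (-τ) * ν.real (closedBall (r⁻¹ • κ i) (ρ * r⁻¹)) ^ (1 / p)) r))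
      (ENNReal.ofReal p) μ ≤
      ENNReal.ofReal (r ^ (-(τ - (p - Module.finrank ℝ E) / p))) *
        (∫⁻ x, ‖fderiv ℝ ψ x‖ₑ ^ p ∂μ) ^ (1 / p) := by
  have hκ' : ∀ i ∈ S, ∀ j ∈ S, i ≠ j → 2 * R < ‖κ i - κ j‖ := fun i hi j hj hij =>
    lt_of_le_of_lt (by linarith) (hκ i hi j hj hij)
  have hweight : ∀ i, ‖r ^ (-τ) * ν.real (closedBall (r⁻¹ • κ i) (ρ * r⁻¹)) ^ (1 / p) * r‖ₑ ^ p =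
      ENNReal.ofReal (r ^ (p - τ * p)) * ν (closedBall (r⁻¹ • κ i) (ρ * r⁻¹)) := by
    intro i
    set B := closedBall (r⁻¹ • κ i) (ρ * r⁻¹)
    rw [Real.enorm_of_nonneg (by positivity), ENNReal.ofReal_rpow_of_nonneg (by positivity) hp.le,
      ← ofReal_measureReal (s := B), ← ENNReal.ofReal_mul (by positivity)]
    congr 1
    rw [Real.mul_rpow (by positivity) hr.le, Real.mul_rpow (by positivity) (by positivity),
      ← Real.rpow_mul measureReal_nonneg, one_div_mul_cancel hp.ne', Real.rpow_one,
      ← Real.rpow_mul hr.le, mul_right_comm, ← Real.rpow_add hr]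
    congr 2
    ring
  have hdisj : ∑ i ∈ S, ν (closedBall (r⁻¹ • κ i) (ρ * r⁻¹)) ≤ 1 := by
    rw [← measure_biUnion_finset _ fun i _ => measurableSet_closedBall]
    · exact prob_le_one
    · intro i hi j hj hij
      refine closedBall_disjoint_closedBall ?_
      rw [dist_eq_norm, ← smul_sub, norm_smul, norm_inv, Real.norm_of_nonneg hr.le, ← two_mul,
        ← mul_assoc, mul_comm r⁻¹]
      exact mul_lt_mul_of_pos_right (hκ i hi j hj hij) (inv_pos.2 hr)
  rw [eLpNorm_eq_lintegral_rpow_enorm_toReal (by simpa using hp) ENNReal.ofReal_ne_top,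
    ENNReal.toReal_ofReal hp.le]
  refine (ENNReal.rpow_le_rpow (lintegral_enorm_fderiv_bumpSum_rpow_le μ hψ hψR hκ' hp hr)
    (by positivity)).trans ?_
  simp only [hweight]
  rw [← Finset.mul_sum]
  calc _ ≤ (ENNReal.ofReal (r ^ (p - τ * p)) * 1 * (ENNReal.ofReal ((r ^ Module.finrank ℝ E)⁻¹) *
        ∫⁻ x, ‖fderiv ℝ ψ x‖ₑ ^ p ∂μ)) ^ (1 / p) := by gcongr
    _ = _ := by
      rw [mul_one, ← mul_assoc, ENNReal.mul_rpow_of_nonneg _ _ (by positivity),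
        ← ENNReal.ofReal_mul (by positivity), ENNReal.ofReal_rpow_of_nonneg (by positivity)
        (by positivity), ← Real.rpow_natCast, ← Real.rpow_neg hr.le, ← Real.rpow_add hr,
        ← Real.rpow_mul hr.le]
      congr 3
      field_simp
      ring

theorem summable_two_pow_rpow_neg {γ : ℝ} (hγ : 0 < γ) :
    Summable fun m : ℕ => ((2 : ℝ) ^ m) ^ (-γ) := by
  have h : ∀ m : ℕ, ((2 : ℝ) ^ m) ^ (-γ) = ((2 : ℝ) ^ (-γ)) ^ m := fun m => by
    rw [← Real.rpow_natCast, ← Real.rpow_natCast, ← Real.rpow_mul two_pos.le,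
      ← Real.rpow_mul two_pos.le, mul_comm]
  simp only [h]
  exact summable_geometric_of_lt_one (by positivity)
    (Real.rpow_lt_one_of_one_lt_of_neg one_lt_two (neg_neg_of_pos hγ))

theorem measure_mul_weight_rpow_le {u : ℝ≥0∞} (hu : u ≠ ∞) {r τ α p : ℝ} (hr : 0 < r) :
    (ENNReal.ofReal (r ^ (-τ)) * u ^ (1 / p)) ^ (-α) * u ≤
      ENNReal.ofReal (r ^ (τ * α)) * u ^ (1 - α / p) := by
  rcases eq_or_ne u 0 with rfl | h0
  · simp
  rw [ENNReal.mul_rpow_of_ne_top ENNReal.ofReal_ne_top (by simp [ENNReal.rpow_eq_top_iff, h0, hu]),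
    ENNReal.ofReal_rpow_of_pos (by positivity), ← Real.rpow_mul hr.le, neg_mul_neg,
    ← ENNReal.rpow_mul, mul_assoc]
  gcongr
  nth_rewrite 2 [← ENNReal.rpow_one u]
  rw [← ENNReal.rpow_add _ _ h0 hu]
  exact (congrArg _ (by ring)).le

/-- The energy bound obtained by summing over the scales that separate two points. -/
theorem exists_lintegral_le_of_scales {X : Type*} [MetricSpace X] [MeasurableSpace X]
    [BorelSpace X] (μ : Measure X) [IsFiniteMeasure μ] {K : Set X} (hμK : μ Kᶜ = 0) {s : ℝ}
    (hs : 0 < s) {A : ℝ≥0∞} (hAt : A ≠ ∞)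
    (hA : ∀ x ∈ K, ∀ r : ℝ, 0 < r → μ (closedBall x r) ≤ A * ENNReal.ofReal r ^ s)
    {ρ τ α p : ℝ} (hρ : 0 < ρ) (hβ : 0 < 1 - α / p) (hτ : τ * α < s * (1 - α / p)) :
    ∃ C : ℝ≥0∞, C ≠ ∞ ∧ ∀ x ∈ K, ∀ F : X → ℝ≥0∞,
      (∀ y ∈ K, x ≠ y → ∃ m : ℕ, dist y x ≤ ρ * ((2 : ℝ) ^ m)⁻¹ ∧
        F y ≤ (ENNReal.ofReal (((2 : ℝ) ^ m) ^ (-τ)) *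
          μ (closedBall x (ρ * ((2 : ℝ) ^ m)⁻¹)) ^ (1 / p)) ^ (-α)) →
      ∫⁻ y, F y ∂μ ≤ C := by
  set β := 1 - α / p
  set γ := s * β - τ * α with hγ
  have hγ0 : 0 < γ := sub_pos.2 hτ
  have hr : ∀ m : ℕ, (0 : ℝ) < 2 ^ m := fun m => by positivity
  refine ⟨∑' m : ℕ, A ^ β * ENNReal.ofReal (ρ ^ (s * β)) * ENNReal.ofReal (((2 : ℝ) ^ m) ^ (-γ)),
    ?_, fun x hx F hF => ?_⟩
  · rw [ENNReal.tsum_mul_left]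
    exact ENNReal.mul_ne_top (ENNReal.mul_ne_top
      (ENNReal.rpow_lt_top_of_nonneg hβ.le hAt).ne ENNReal.ofReal_ne_top)
      (summable_two_pow_rpow_neg hγ0).tsum_ofReal_ne_top
  set B : ℕ → Set X := fun m => closedBall x (ρ * ((2 : ℝ) ^ m)⁻¹)
  set w : ℕ → ℝ≥0∞ := fun m =>
    (ENNReal.ofReal (((2 : ℝ) ^ m) ^ (-τ)) * μ (B m) ^ (1 / p)) ^ (-α)
  have hsingle : μ {x} = 0 := by
    have hlim : Tendsto (fun r : ℝ => A * ENNReal.ofReal r ^ s) (𝓝[>] 0) (𝓝 0) := by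
      have h1 : Tendsto (fun r : ℝ => ENNReal.ofReal r ^ s) (𝓝 0) (𝓝 (ENNReal.ofReal 0 ^ s)) :=
        ((ENNReal.continuous_rpow_const (y := s)).comp ENNReal.continuous_ofReal).tendsto 0
      rw [ENNReal.ofReal_zero, ENNReal.zero_rpow_of_pos hs] at h1
      have h2 := ENNReal.Tendsto.const_mul h1 (Or.inr hAt)
      rw [mul_zero] at h2
      exact h2.mono_left nhdsWithin_le_nhds
    refine nonpos_iff_eq_zero.1 (ge_of_tendsto hlim ?_)
    filter_upwards [self_mem_nhdsWithin] with r hr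
    exact (measure_mono (singleton_subset_iff.2 (mem_closedBall_self (le_of_lt hr)))).trans
      (hA x hx r hr)
  have hae : ∀ᵐ y ∂μ, F y ≤ ∑' m, (B m).indicator (fun _ => w m) y := by
    have h1 : ∀ᵐ y ∂μ, y ∈ K := by rwa [ae_iff]
    have h2 : ∀ᵐ y ∂μ, y ∉ ({x} : Set X) := measure_eq_zero_iff_ae_notMem.1 hsingle
    filter_upwards [h1, h2] with y hy hyx
    obtain ⟨m, hm, hFm⟩ := hF y hy fun h => hyx h.symm
    refine hFm.trans (le_trans ?_ (ENNReal.le_tsum m))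
    rw [indicator_of_mem (show y ∈ B m from hm)]
  refine (lintegral_mono_ae hae).trans ?_
  rw [lintegral_tsum fun m => (measurable_const.indicator measurableSet_closedBall).aemeasurable]
  refine ENNReal.tsum_le_tsum fun m => ?_
  rw [lintegral_indicator measurableSet_closedBall, setLIntegral_const]
  refine (measure_mul_weight_rpow_le (measure_ne_top μ _) (hr m)).trans ?_
  calc _ ≤ ENNReal.ofReal (((2 : ℝ) ^ m) ^ (τ * α)) *
        (A * ENNReal.ofReal (ρ * ((2 : ℝ) ^ m)⁻¹) ^ s) ^ β := by
        gcongr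
        exact hA x hx _ (mul_pos hρ (inv_pos.2 (hr m)))
    _ = _ := by
        rw [ENNReal.mul_rpow_of_nonneg _ _ hβ.le, ← ENNReal.rpow_mul,
          ENNReal.ofReal_rpow_of_nonneg (by positivity) (by positivity), mul_left_comm, mul_assoc,
          ← ENNReal.ofReal_mul (by positivity), ← ENNReal.ofReal_mul (by positivity)]
        congr 2
        rw [Real.mul_rpow hρ.le (by positivity), ← Real.rpow_neg_one, ← Real.rpow_mul (hr m).le,
          mul_left_comm, ← Real.rpow_add (hr m)]
        congr 2
        rw [hγ]; ring

/-- A countable family of functions, bounded in `W^{1,p}`, that separates the points of `K` on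
average with respect to a Frostman measure. -/
theorem exists_family_lintegral_iInf_ne_top {n : ℕ} {p s α : ℝ} (hpn : (n : ℝ) < p) (hα : 0 < α)
    (hs : 0 < s) (hαs : α * (p - n + s) < p * s) {K : Set (EuclideanSpace ℝ (Fin n))}
    {z : EuclideanSpace ℝ (Fin n)} (hKz : K ⊆ closedBall z 1)
    (μ : Measure (EuclideanSpace ℝ (Fin n))) [IsProbabilityMeasure μ] (hμK : μ Kᶜ = 0)
    {A : ℝ≥0∞} (hAt : A ≠ ∞)
    (hA : ∀ x ∈ K, ∀ r : ℝ, 0 < r → μ (closedBall x r) ≤ A * ENNReal.ofReal r ^ s) :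
    ∃ (g : ℕ × (Fin n → ZMod (18 * (n + 1) + 1)) → EuclideanSpace ℝ (Fin n) → ℝ)
      (b : ℕ × (Fin n → ZMod (18 * (n + 1) + 1)) → ℝ), Summable b ∧ (∀ j x, ‖g j x‖ ≤ b j) ∧
      (∀ j, ContDiff ℝ 1 (g j)) ∧
      (∀ j, eLpNorm (fderiv ℝ (g j)) (ENNReal.ofReal p) volume ≤ ENNReal.ofReal (b j)) ∧
      ∫⁻ x, ∫⁻ y, ⨅ j, ‖g j x - g j y‖ₑ ^ (-α) ∂μ ∂μ ≠ ∞ := by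
  have hp : 0 < p := n.cast_nonneg.trans_lt hpn
  have hβ : 0 < 1 - α / p := by
    rw [sub_pos, div_lt_one hp]
    nlinarith
  obtain ⟨τ, hτ1, hτ2⟩ : ∃ τ, (p - n) / p < τ ∧ τ < s * (1 - α / p) / α := by
    refine exists_between ?_
    rw [lt_div_iff₀ hα, div_mul_eq_mul_div, div_lt_iff₀ hp, mul_assoc,
      sub_mul 1, div_mul_cancel₀ _ hp.ne']
    linarith
  rw [lt_div_iff₀ hα] at hτ2
  set Q : ℝ := n + 1 with hQ
  have hQ0 : 0 < Q := by positivity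
  let ψ : ContDiffBump (0 : EuclideanSpace ℝ (Fin n)) := ⟨Q, 2 * Q, hQ0, by linarith⟩
  have hψ : ContDiff ℝ 1 ψ := ψ.contDiff
  have hψ0 : ∀ v, 2 * Q ≤ ‖v‖ → ψ v = 0 := fun v hv =>
    ψ.zero_of_le_dist (by rwa [dist_zero_right])
  have hψ1 : ∀ v, ‖v‖ ≤ Q → ψ v = 1 := fun v hv =>
    ψ.one_of_mem_closedBall (by rwa [mem_closedBall_zero_iff])
  have hψle : ∀ v, ‖ψ v‖ ≤ 1 := fun v => by
    rw [Real.norm_of_nonneg ψ.nonneg]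
    exact ψ.le_one
  set I := ∫⁻ x, ‖fderiv ℝ ψ x‖ₑ ^ p with hI
  have hIt : I ≠ ∞ := by
    have h1 : MemLp (fderiv ℝ ψ) (ENNReal.ofReal p) volume :=
      (hψ.continuous_fderiv one_ne_zero).memLp_of_hasCompactSupport
        (ψ.hasCompactSupport.fderiv (𝕜 := ℝ))
    have := lintegral_rpow_enorm_lt_top_of_eLpNorm_lt_top (by simpa using hp) (by simp)
      h1.eLpNorm_lt_top
    rw [ENNReal.toReal_ofReal hp.le] at this
    exact this.ne
  have hI1 : I ^ (1 / p) ≠ ∞ := (ENNReal.rpow_lt_top_of_nonneg (by positivity) hIt).ne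
  have hr : ∀ m : ℕ, (0 : ℝ) < 2 ^ m := fun m => by positivity
  have hr1 : ∀ m : ℕ, (1 : ℝ) ≤ 2 ^ m := fun m => one_le_pow₀ one_le_two
  let S : ℕ → (Fin n → ZMod (18 * (n + 1) + 1)) → Finset (Fin n → ℤ) := fun m c =>
    (finite_image_latticeFloor_smul (isBounded_closedBall.subset hKz) (hr m).le).toFinset.filter
      fun k => (fun i => (k i : ZMod (18 * (n + 1) + 1))) = c
  have hS : ∀ m c k, k ∈ S m c ↔ (∃ x ∈ K, latticeFloor ((2 : ℝ) ^ m • x) = k) ∧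
      (fun i => (k i : ZMod (18 * (n + 1) + 1))) = c := by
    intro m c k
    simp [S]
  have hsep : ∀ m c, ∀ k ∈ S m c, ∀ l ∈ S m c, k ≠ l →
      2 * (9 * Q) < ‖latticePoint k - latticePoint l‖ := by
    intro m c k hk l hl hkl
    refine lt_of_lt_of_le ?_ (le_norm_latticePoint_sub hkl fun i =>
      congrFun (((hS m c k).1 hk).2.trans ((hS m c l).1 hl).2.symm) i)
    push_cast
    linarith
  have hsep' : ∀ m c, ∀ k ∈ S m c, ∀ l ∈ S m c, k ≠ l →
      2 * (2 * Q) < ‖latticePoint k - latticePoint l‖ := fun m c k hk l hl hkl =>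
    lt_of_le_of_lt (by linarith) (hsep m c k hk l hl hkl)
  let a : ℕ → (Fin n → ℤ) → ℝ := fun m k => ((2 : ℝ) ^ m) ^ (-τ) *
    μ.real (closedBall (((2 : ℝ) ^ m)⁻¹ • latticePoint k) (9 * Q * ((2 : ℝ) ^ m)⁻¹)) ^ (1 / p)
  set ε := τ - (p - n) / p with hε
  have hε0 : 0 < ε := sub_pos.2 hτ1
  have hετ : ε ≤ τ := sub_le_self _ (div_nonneg (sub_nonneg.2 hpn.le) hp.le)
  let g : ℕ × (Fin n → ZMod (18 * (n + 1) + 1)) → EuclideanSpace ℝ (Fin n) → ℝ := fun j =>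
    bumpSum ψ (S j.1 j.2) latticePoint (a j.1) (2 ^ j.1)
  let b : ℕ × (Fin n → ZMod (18 * (n + 1) + 1)) → ℝ := fun j =>
    ((2 : ℝ) ^ j.1) ^ (-ε) * (1 + (I ^ (1 / p)).toReal)
  have hale : ∀ m k, ‖a m k‖ ≤ ((2 : ℝ) ^ m) ^ (-ε) := by
    intro m k
    rw [Real.norm_of_nonneg (by positivity)]
    calc a m k ≤ ((2 : ℝ) ^ m) ^ (-τ) * 1 := by
          simp only [a]
          gcongr
          exact Real.rpow_le_one measureReal_nonneg measureReal_le_one (by positivity)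
      _ ≤ ((2 : ℝ) ^ m) ^ (-ε) := by
          rw [mul_one]
          exact Real.rpow_le_rpow_of_exponent_le (hr1 m) (by linarith)
  refine ⟨g, b, ?_, fun j x => ?_, fun j => contDiff_bumpSum hψ, fun j => ?_, ?_⟩
  · have h1 := (summable_two_pow_rpow_neg hε0).mul_right (1 + (I ^ (1 / p)).toReal)
    have h2 : Summable fun _ : Fin n → ZMod (18 * (n + 1) + 1) => (1 : ℝ) := Summable.of_finite
    simpa [b] using h1.mul_of_nonneg h2 (fun m => by positivity) (fun _ => zero_le_one)
  · refine (norm_bumpSum_le hψ0 hψle (hsep' j.1 j.2) (by positivity)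
      (fun k _ => hale j.1 k) x).trans ?_
    exact le_mul_of_one_le_right (by positivity) (by simp)
  · have := eLpNorm_fderiv_bumpSum_le volume μ hψ (by linarith : 2 * Q ≤ 9 * Q) hψ0
      (hsep j.1 j.2) hp (hr j.1) τ
    refine this.trans ?_
    rw [finrank_euclideanSpace_fin, ← ENNReal.ofReal_toReal hI1,
      ← ENNReal.ofReal_mul (by positivity)]
    refine ENNReal.ofReal_le_ofReal ?_
    simp only [b]
    gcongr
    linarith
  obtain ⟨C, hCt, hC⟩ := exists_lintegral_le_of_scales μ hμK hs hAt hA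
    (by positivity : 0 < 8 * Q) hβ hτ2
  have hK : ∀ᵐ x ∂μ, x ∈ K := by rwa [ae_iff]
  refine ne_top_of_le_ne_top hCt ((lintegral_mono_ae (g := fun _ => C) ?_).trans (by simp))
  filter_upwards [hK] with x hx
  refine hC x hx _ fun y hy hxy => ?_
  have hd : 0 < dist y x := dist_pos.2 hxy.symm
  have hd2 : dist y x ≤ 2 := by
    have h1 := mem_closedBall.1 (hKz hx)
    have h2 := mem_closedBall.1 (hKz hy)
    linarith [dist_triangle_right y x z]
  have h1Q : 1 ≤ 8 * Q / dist y x := by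
    rw [one_le_div hd, hQ]
    linarith [n.cast_nonneg (α := ℝ)]
  obtain ⟨m, hm1, hm2⟩ := exists_nat_pow_near h1Q one_lt_two
  rw [le_div_iff₀ hd] at hm1
  rw [div_lt_iff₀ hd, pow_succ] at hm2
  refine ⟨m, ?_, iInf_le_of_le (m, fun i => (latticeFloor ((2 : ℝ) ^ m • x) i :
    ZMod (18 * (n + 1) + 1))) ?_⟩
  · rw [← div_eq_mul_inv, le_div_iff₀ (hr m)]
    linarith
  set k := latticeFloor ((2 : ℝ) ^ m • x) with hk
  set c : Fin n → ZMod (18 * (n + 1) + 1) := fun i => (k i : ZMod (18 * (n + 1) + 1)) with hc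
  have hkS : k ∈ S m c := (hS m c k).2 ⟨⟨x, hx, rfl⟩, rfl⟩
  have hxk : ‖(2 : ℝ) ^ m • x - latticePoint k‖ ≤ n := norm_sub_latticePoint_latticeFloor_le _
  have hyx : ‖(2 : ℝ) ^ m • y - (2 : ℝ) ^ m • x‖ = 2 ^ m * dist y x := by
    rw [← smul_sub, norm_smul, Real.norm_of_nonneg (hr m).le, dist_eq_norm]
  have hgx : g (m, c) x = a m k := by
    change bumpSum ψ (S m c) latticePoint (a m) (2 ^ m) x = _
    rw [bumpSum_eq_of_norm_sub_le hψ0 (hsep' m c) hkS (by linarith), hψ1 _ (by linarith), mul_one]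
  have hgy : g (m, c) y = 0 := by
    refine bumpSum_eq_zero hψ0 fun l hl => ?_
    rcases eq_or_ne k l with rfl | hkl
    · have := norm_sub_le_norm_sub_add_norm_sub ((2 : ℝ) ^ m • y) (latticePoint k)
        ((2 : ℝ) ^ m • x)
      rw [norm_sub_rev (latticePoint k)] at this
      linarith
    · have h1 := hsep m c k hkS l hl hkl
      have h2 := norm_sub_le_norm_sub_add_norm_sub (latticePoint k) ((2 : ℝ) ^ m • x)
        (latticePoint l)
      have h3 := norm_sub_le_norm_sub_add_norm_sub ((2 : ℝ) ^ m • x) ((2 : ℝ) ^ m • y)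
        (latticePoint l)
      rw [norm_sub_rev (latticePoint k) ((2 : ℝ) ^ m • x)] at h2
      rw [norm_sub_rev ((2 : ℝ) ^ m • x) ((2 : ℝ) ^ m • y)] at h3
      linarith
  rw [hgx, hgy, sub_zero, Real.enorm_of_nonneg (by positivity)]
  rw [ENNReal.rpow_neg, ENNReal.rpow_neg, ENNReal.inv_le_inv]
  refine ENNReal.rpow_le_rpow ?_ hα.le
  rw [ENNReal.ofReal_mul (by positivity), ← ENNReal.ofReal_rpow_of_nonneg measureReal_nonneg
    (by positivity), ofReal_measureReal]
  gcongr
  refine closedBall_subset_closedBall' ?_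
  have hxk' : dist x (((2 : ℝ) ^ m)⁻¹ • latticePoint k) ≤ Q * ((2 : ℝ) ^ m)⁻¹ := by
    rw [dist_eq_norm, ← div_eq_mul_inv, le_div_iff₀ (hr m), mul_comm]
    calc _ = ‖(2 : ℝ) ^ m • (x - ((2 : ℝ) ^ m)⁻¹ • latticePoint k)‖ := by
          rw [norm_smul, Real.norm_of_nonneg (hr m).le]
      _ ≤ Q := by
          rw [smul_sub, smul_inv_smul₀ (hr m).ne']
          linarith
  linarith

theorem exists_hausdorffMeasure_inter_closedBall_ne_zero {n : ℕ}
    {E : Set (EuclideanSpace ℝ (Fin n))} {t : ℝ} (ht : 0 ≤ t) (h : ENNReal.ofReal t < dimH E) :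
    ∃ z, μH[t] (E ∩ closedBall z 1) ≠ 0 := by
  by_contra! hz
  have hE : E ⊆ ⋃ i, E ∩ closedBall (TopologicalSpace.denseSeq (EuclideanSpace ℝ (Fin n)) i) 1 := by
    intro x hx
    obtain ⟨i, hi⟩ := (TopologicalSpace.denseRange_denseSeq
      (EuclideanSpace ℝ (Fin n))).exists_dist_lt x one_pos
    exact mem_iUnion.2 ⟨i, hx, hi.le⟩
  have h0 : μH[t] E = 0 :=
    measure_mono_null hE (measure_iUnion_null fun i => hz _)
  have h1 : μH[(t.toNNReal : ℝ)] E = ∞ := hausdorffMeasure_of_lt_dimH h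
  rw [Real.coe_toNNReal t ht, h0] at h1
  exact ENNReal.zero_ne_top h1

/-- A sequence of families of Sobolev functions can be rescaled to form a single one. -/
theorem exists_summable_rescaling {n : ℕ} {J : Type*} {p : ℝ}
    {g : ℕ → J → EuclideanSpace ℝ (Fin n) → ℝ} {b : ℕ → J → ℝ} (hb : ∀ k, Summable (b k))
    (hgb : ∀ k j x, ‖g k j x‖ ≤ b k j) (hgs : ∀ k j, ContDiff ℝ 1 (g k j))
    (hgd : ∀ k j, eLpNorm (fderiv ℝ (g k j)) (ENNReal.ofReal p) volume ≤ ENNReal.ofReal (b k j)) :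
    ∃ δ : ℕ → ℝ, (∀ k, 0 < δ k) ∧ Summable (fun i : ℕ × J => δ i.1 * b i.1 i.2) ∧
      (∀ (i : ℕ × J) x, ‖(δ i.1 • g i.1 i.2) x‖ ≤ δ i.1 * b i.1 i.2) ∧
      (∀ i : ℕ × J, ContDiff ℝ 1 (δ i.1 • g i.1 i.2)) ∧
      ∀ i : ℕ × J, eLpNorm (fderiv ℝ (δ i.1 • g i.1 i.2)) (ENNReal.ofReal p) volume ≤
        ENNReal.ofReal (δ i.1 * b i.1 i.2) := by
  have hb0 : ∀ k j, 0 ≤ b k j := fun k j => (norm_nonneg _).trans (hgb k j 0)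
  have hS : ∀ k, 0 ≤ ∑' j, b k j := fun k => tsum_nonneg (hb0 k)
  obtain ⟨δ, hδ, hδS⟩ : ∃ δ : ℕ → ℝ, (∀ k, 0 < δ k) ∧
      ∀ k, δ k * ∑' j, b k j ≤ (1 / 2 : ℝ) ^ k := by
    refine ⟨fun k => (1 / 2 : ℝ) ^ k / (1 + ∑' j, b k j),
      fun k => div_pos (by positivity) (by linarith [hS k]), fun k => ?_⟩
    have := hS k
    dsimp only
    rw [div_mul_eq_mul_div, div_le_iff₀ (by linarith)]
    gcongr
    linarith
  have h0 : ∀ k j, 0 ≤ δ k * b k j := fun k j => mul_nonneg (hδ k).le (hb0 k j)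
  refine ⟨δ, hδ, ?_, ?_, ?_, ?_⟩
  · have hnn : 0 ≤ fun i : ℕ × J => δ i.1 * b i.1 i.2 := fun i => h0 i.1 i.2
    rw [summable_prod_of_nonneg hnn]
    refine ⟨fun k => (hb k).mul_left (δ k), ?_⟩
    refine Summable.of_nonneg_of_le (fun k => tsum_nonneg fun j => h0 k j) (fun k => ?_)
      (summable_geometric_of_lt_one (by norm_num) (by norm_num : (1 / 2 : ℝ) < 1))
    simpa only [tsum_mul_left] using hδS k
  · intro i x
    rw [Pi.smul_apply, norm_smul, Real.norm_of_nonneg (hδ i.1).le]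
    exact mul_le_mul_of_nonneg_left (hgb _ _ _) (hδ i.1).le
  · exact fun i => (hgs i.1 i.2).const_smul (δ i.1)
  · intro i
    have hd : fderiv ℝ (δ i.1 • g i.1 i.2) = δ i.1 • fderiv ℝ (g i.1 i.2) := by
      ext1 x
      exact fderiv_const_smul ((hgs i.1 i.2).differentiable one_ne_zero x) _
    rw [hd]
    refine (eLpNorm_const_smul (δ i.1) (fderiv ℝ (g i.1 i.2)) _ _).trans_le ?_
    rw [ENNReal.ofReal_mul (hδ i.1).le, Real.enorm_eq_ofReal (hδ i.1).le]
    gcongr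
    exact hgd _ _

theorem lintegral_iInf_rescaling_ne_top {X J : Type*} [MeasurableSpace X] {μ : Measure X}
    {g : ℕ → J → X → ℝ} {δ : ℕ → ℝ} {α : ℝ} {k : ℕ} (hδ : 0 < δ k)
    (h : ∫⁻ x, ∫⁻ y, ⨅ j, ‖g k j x - g k j y‖ₑ ^ (-α) ∂μ ∂μ ≠ ∞) :
    ∫⁻ x, ∫⁻ y, ⨅ i : ℕ × J,
      ‖(δ i.1 • g i.1 i.2) x - (δ i.1 • g i.1 i.2) y‖ₑ ^ (-α) ∂μ ∂μ ≠ ∞ := by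
  have h0 : ‖δ k‖ₑ ≠ 0 := by simpa using hδ.ne'
  have hc : ‖δ k‖ₑ ^ (-α) ≠ ∞ := ENNReal.rpow_ne_top_of_ne_zero h0 enorm_ne_top
  have hc0 : ‖δ k‖ₑ ^ (-α) ≠ 0 := by
    simp [ENNReal.rpow_eq_zero_iff, hδ.ne']
  refine ne_top_of_le_ne_top (ENNReal.mul_ne_top hc h) ?_
  rw [← lintegral_const_mul' _ _ hc]
  refine lintegral_mono fun x => ?_
  rw [← lintegral_const_mul' _ _ hc]
  refine lintegral_mono fun y => ?_
  rw [ENNReal.mul_iInf_of_ne hc0 hc]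
  refine le_iInf fun j => (iInf_le _ (k, j)).trans_eq ?_
  simp only [Pi.smul_apply, ← smul_sub]
  rw [enorm_smul, ENNReal.mul_rpow_of_ne_top enorm_ne_top enorm_ne_top]

theorem exists_exponent_lt {n p s α : ℝ} (hn : 0 < n) (hs0 : 0 < s) (hp : n < p)
    (hα0 : 0 < α) (hα : α < p * s / (p - n + s)) :
    ∃ t, 0 < t ∧ t < s ∧ α * (p - n + t) < p * t := by
  rw [lt_div_iff₀ (by linarith)] at hα
  have hαp : α < p := by
    by_contra! h
    nlinarith [mul_le_mul_of_nonneg_right h (by linarith : 0 ≤ p - n + s)]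
  have h1 : α * (p - n) / (p - α) < s := by
    rw [div_lt_iff₀ (by linarith)]
    nlinarith
  obtain ⟨t, ht, hts⟩ := exists_between h1
  refine ⟨t, lt_of_le_of_lt (div_nonneg ?_ (by linarith)) ht, hts, ?_⟩
  · exact mul_nonneg hα0.le (by linarith)
  · rw [div_lt_iff₀ (by linarith)] at ht
    linarith

/-- A closed set of large dimension carries, inside a compact piece, a probability measure with
a family of Sobolev functions separating its points on average. -/
theorem exists_measure_family_of_lt_dimH {n : ℕ} {p t α : ℝ} (hpn : (n : ℝ) < p) (hα : 0 < α)
    (ht : 0 < t) (hαt : α * (p - n + t) < p * t)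
    {E : Set (EuclideanSpace ℝ (Fin n))} (hE : IsClosed E) (hdim : ENNReal.ofReal t < dimH E) :
    ∃ (K : Set (EuclideanSpace ℝ (Fin n))) (μ : Measure (EuclideanSpace ℝ (Fin n)))
      (g : ℕ × (Fin n → ZMod (18 * (n + 1) + 1)) → EuclideanSpace ℝ (Fin n) → ℝ)
      (b : ℕ × (Fin n → ZMod (18 * (n + 1) + 1)) → ℝ),
      K ⊆ E ∧ MeasurableSet K ∧ IsProbabilityMeasure μ ∧ μ K ≠ 0 ∧
      Summable b ∧ (∀ j x, ‖g j x‖ ≤ b j) ∧ (∀ j, ContDiff ℝ 1 (g j)) ∧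
      (∀ j, eLpNorm (fderiv ℝ (g j)) (ENNReal.ofReal p) volume ≤ ENNReal.ofReal (b j)) ∧
      ∫⁻ x, ∫⁻ y, ⨅ j, ‖g j x - g j y‖ₑ ^ (-α) ∂μ ∂μ ≠ ∞ := by
  obtain ⟨z, hz⟩ := exists_hausdorffMeasure_inter_closedBall_ne_zero ht.le hdim
  have hK : IsCompact (E ∩ closedBall z 1) := (isCompact_closedBall z 1).inter_left hE
  obtain ⟨μ, hμ, hμK, A, hA, hAμ⟩ := exists_measure_closedBall_le_rpow hK ht hz
  obtain ⟨g, b, h⟩ := exists_family_lintegral_iInf_ne_top hpn hα ht hαt inter_subset_right μ hμK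
    hA hAμ
  refine ⟨_, μ, g, b, inter_subset_left, hK.measurableSet, hμ, fun h0 => ?_, h⟩
  have := measure_univ_le_add_compl (μ := μ) (E ∩ closedBall z 1)
  simp [h0, hμK] at this

/-- Kaufman's sharpness theorem: for any closed `E ⊆ ℝ^n` with `dimH E ≥ s` and any
`p > n`, there is a continuous `f ∈ W^{1,p}(ℝ^n : ℝ^n)` with
`dimH f(E) ≥ ps/(p-n+s)`. -/
theorem kaufman_sharpness (n : ℕ) (s : ℝ) (hs0 : 0 < s) (hsn : s ≤ n)
    (E : Set (EuclideanSpace ℝ (Fin n))) (hE : IsClosed E)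
    (hdim : ENNReal.ofReal s ≤ dimH E) (p : ℝ) (hp : (n : ℝ) < p) :
    ∃ f : EuclideanSpace ℝ (Fin n) → EuclideanSpace ℝ (Fin n),
      Continuous f ∧ MemW1p n n p Set.univ f ∧
      ENNReal.ofReal (p*s/(p - n + s)) ≤ dimH (f '' E) := by
  have hn : (0 : ℝ) < n := hs0.trans_le hsn
  have hp0 : 0 < p := hn.trans hp
  have hd : 0 < p - n + s := by linarith
  set β : ℝ := p * s / (p - n + s) with hβ
  have hβ0 : 0 < β := div_pos (mul_pos hp0 hs0) hd
  have hβn : β ≤ n := by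
    rw [hβ, div_le_iff₀ hd]
    nlinarith [mul_nonneg (sub_nonneg.2 hp.le) (sub_nonneg.2 hsn)]
  obtain ⟨α, -, hαβ, hαlim⟩ := exists_seq_strictMono_tendsto' hβ0
  choose t ht0 hts ht using fun k => exists_exponent_lt hn hs0 hp (hαβ k).1 (hαβ k).2
  choose K μ g b hKE hKm hμ hμK hb hgb hgs hgd hfin using
    fun k => exists_measure_family_of_lt_dimH hp (hαβ k).1 (ht0 k) (ht k) hE
      (((ENNReal.ofReal_lt_ofReal_iff hs0).2 (hts k)).trans_le hdim)
  obtain ⟨δ, hδ, hb', hgb', hgs', hgd'⟩ := exists_summable_rescaling hb hgb hgs hgd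
  have hae := ae_all_iff.2 fun k => ae_lintegral_vectorSeries_ne_top (hαβ k).1
    ((hαβ k).2.trans_le hβn) hb' hgb' (fun i => (hgs' i).continuous) (μ k)
    (lintegral_iInf_rescaling_ne_top (hδ k) (hfin k))
  obtain ⟨ξ, hξ⟩ := hae.exists
  have hcont : Continuous (vectorSeries (fun i => δ i.1 • g i.1 i.2) ξ) :=
    (continuous_vectorSeries hb' hgb' fun i => (hgs' i).continuous).comp
      (Continuous.prodMk_right ξ)
  refine ⟨_, hcont, memW1p_vectorSeries ?_ hb' hgb' hgs' hgd' ξ, ?_⟩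
  · have h1 : (1 : ℝ) ≤ n := by exact_mod_cast Nat.one_le_iff_ne_zero.2 (by rintro rfl; simp at hn)
    exact h1.trans_lt hp
  · refine le_of_tendsto' ((ENNReal.continuous_ofReal.tendsto _).comp hαlim) fun k => ?_
    exact (le_dimH_image_of_lintegral_edist_rpow_ne_top hcont (hKm k) (μ k) (hμK k) (hαβ k).1
      (hξ k)).trans (dimH_mono (image_mono (hKE k)))
end
end
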